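/- arXiv:1801.06614 — 8 statements merged into one kernel-verified Lean document; each statement's English description precedes it below -/
import Mathlib

section
/- Fix K ∈ (0,1]. Let m, ρ : (0,∞) → ℝ be differentiable with ρ(r) > 0 and r - 2m(r) > 0 for all r > 0, satisfying m'(r) = 4π r^2 ρ(r) and ρ'(r) = -((1+K) ρ(r)/(r - 2 m(r))) · (4π r^2 ρ(r) + m(r)/(r K)). Define, for t ∈ ℝ, a(t) = -log(1 - 2 m(e^t)/e^t) and b(t) = log(4π e^{2t} ρ(e^t)) + a(t). Then (a,b) solves the autonomous system ȧ(t) = 1 - e^{a(t)} + 2 e^{b(t)} and ḃ(t) = (1+7K)/(2K) - ((1+3K)/(2K)) e^{a(t)} + (1-K) e^{b(t)} for all t ∈ ℝ. -/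
open Real

/-- For a positive solution (m, ρ) of the static spherically symmetric
Einstein–Euler system with linear equation of state p = Kρ, the functions
a(t) = -log(1 - 2m(e^t)/e^t) and b(t) = log(4π e^{2t} ρ(e^t)) + a(t) solve the autonomous
system ȧ = 1 - e^a + 2e^b, ḃ = (1+7K)/(2K) - ((1+3K)/(2K))e^a + (1-K)e^b. -/
theorem EE_linear_autonomous_reformulation (K : ℝ) (hK : K ∈ Set.Ioc (0:ℝ) 1)
    (m ρ : ℝ → ℝ)
    (hρpos : ∀ r > (0:ℝ), 0 < ρ r)
    (hhor : ∀ r > (0:ℝ), 0 < r - 2 * m r)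
    (hm : ∀ r > (0:ℝ), HasDerivAt m (4 * π * r^2 * ρ r) r)
    (hρ : ∀ r > (0:ℝ), HasDerivAt ρ
      (-((1+K) * ρ r / (r - 2 * m r)) * (4 * π * r^2 * ρ r + m r / (r * K))) r)
    (a b : ℝ → ℝ)
    (ha : ∀ t, a t = -Real.log (1 - 2 * m (Real.exp t) / Real.exp t))
    (hb : ∀ t, b t = Real.log (4 * π * Real.exp (2*t) * ρ (Real.exp t)) + a t) :
    ∀ t : ℝ,
      HasDerivAt a (1 - Real.exp (a t) + 2 * Real.exp (b t)) t ∧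
      HasDerivAt b ((1+7*K)/(2*K) - ((1+3*K)/(2*K)) * Real.exp (a t)
        + (1-K) * Real.exp (b t)) t := by
  intro t
  have hK0 : K ≠ 0 := hK.1.ne'
  have hr : 0 < Real.exp t := Real.exp_pos t
  have hρt := hρpos _ hr
  have hd := hhor _ hr
  have hexp := Real.hasDerivAt_exp t
  have hmexp := (hm _ hr).comp t hexp
  have hρexp := (hρ _ hr).comp t hexp
  have hexp2 : HasDerivAt (fun s : ℝ => Real.exp (2 * s)) (Real.exp (2 * t) * (2 * 1)) t :=
    ((hasDerivAt_id t).const_mul 2).exp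
  have hsq : Real.exp (2 * t) = Real.exp t ^ 2 := by rw [← Real.exp_nat_mul]; norm_num
  have hu : 0 < 1 - 2 * m (Real.exp t) / Real.exp t := by
    rw [one_sub_div hr.ne']; positivity
  have hv : 0 < 4 * π * Real.exp (2 * t) * ρ (Real.exp t) := by positivity
  have hea : Real.exp (a t) = Real.exp t / (Real.exp t - 2 * m (Real.exp t)) := by
    rw [ha, Real.exp_neg, Real.exp_log hu, one_sub_div hr.ne', inv_div]
  have heb : Real.exp (b t) = 4 * π * Real.exp t ^ 2 * ρ (Real.exp t) *
      (Real.exp t / (Real.exp t - 2 * m (Real.exp t))) := by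
    rw [hb, Real.exp_add, Real.exp_log hv, hea, hsq]
  have hda : HasDerivAt a (1 - Real.exp (a t) + 2 * Real.exp (b t)) t := by
    have h := ((((hmexp.const_mul 2).div hexp hr.ne').const_sub 1).log hu.ne').neg
    rw [hea, heb, funext ha]
    refine h.congr_deriv ?_
    simp only [Function.comp_apply, Pi.div_apply]
    rw [one_sub_div hr.ne']
    have hdne := hd.ne'
    field_simp
    ring
  refine ⟨hda, ?_⟩
  have h := (((hexp2.const_mul (4 * π)).mul hρexp).log hv.ne').add hda
  rw [hea, heb] at h ⊢
  rw [funext hb]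
  refine h.congr_deriv ?_
  simp only [Function.comp_apply, Pi.mul_apply]
  rw [hsq]
  have hdne := hd.ne'
  have hρne := hρt.ne'
  field_simp
  ring
end

section
/- Fix K ∈ (0,1]. Consider the real 2×2 matrix A_∞ with rows (−((1+K)^2+4K)/(1+K)^2 , 4K/(1+K)^2) and (−((1+3K)/(2K))·((1+K)^2+4K)/(1+K)^2 , 2K(1−K)/(1+K)^2). Regarded as a complex matrix, A_∞ has exactly the two eigenvalues λ± = −(1+3K)/(2(1+K)) ± i·√(7+42K−K^2)/(2(1+K)); moreover their common real part −(1+3K)/(2(1+K)) satisfies −1 ≤ −(1+3K)/(2(1+K)) < −1/2. -/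
open Real Complex

/-- A `2 × 2` matrix over a field whose trace and determinant are `x + y` and `x * y` has
spectrum `{x, y}`. -/
theorem Matrix.spectrum_fin_two_of_trace_det {F : Type*} [Field F] (M : Matrix (Fin 2) (Fin 2) F)
    {x y : F} (htrace : M.trace = x + y) (hdet : M.det = x * y) : spectrum F M = {x, y} := by
  ext z
  have hfactor : M.charpoly.eval z = (z - x) * (z - y) := by
    rw [Matrix.charpoly_fin_two, htrace, hdet]
    simp only [Polynomial.eval_add, Polynomial.eval_sub, Polynomial.eval_mul, Polynomial.eval_pow,
      Polynomial.eval_X, Polynomial.eval_C]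
    ring
  rw [Matrix.mem_spectrum_iff_isRoot_charpoly, Polynomial.IsRoot.def, hfactor, mul_eq_zero,
    sub_eq_zero, sub_eq_zero, Set.mem_insert_iff, Set.mem_singleton_iff]

/-- The Jacobian matrix A_∞ at the fixed point, regarded as a complex matrix,
has exactly the two eigenvalues λ± = −(1+3K)/(2(1+K)) ± i√(7+42K−K²)/(2(1+K)), and the
common real part satisfies −1 ≤ −(1+3K)/(2(1+K)) < −1/2. -/
theorem eigenvalues_of_linearization (K : ℝ) (hK : K ∈ Set.Ioc (0:ℝ) 1) :
    spectrum ℂ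
      (!![((-(((1+K)^2 + 4*K)/(1+K)^2) : ℝ) : ℂ), (((4*K/(1+K)^2) : ℝ) : ℂ);
          (((-((1+3*K)/(2*K)) * (((1+K)^2 + 4*K)/(1+K)^2)) : ℝ) : ℂ),
          (((2*K*(1-K)/(1+K)^2) : ℝ) : ℂ)] : Matrix (Fin 2) (Fin 2) ℂ)
      = {((-(1+3*K)/(2*(1+K)) : ℝ) : ℂ)
            + Complex.I * ((Real.sqrt (7 + 42*K - K^2) / (2*(1+K)) : ℝ) : ℂ),
         ((-(1+3*K)/(2*(1+K)) : ℝ) : ℂ)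
            - Complex.I * ((Real.sqrt (7 + 42*K - K^2) / (2*(1+K)) : ℝ) : ℂ)} ∧
    (-1 : ℝ) ≤ -(1+3*K)/(2*(1+K)) ∧ -(1+3*K)/(2*(1+K)) < -1/2 := by
  obtain ⟨hpos, hle⟩ := hK
  have hK0 : (K : ℂ) ≠ 0 := by exact_mod_cast hpos.ne'
  have hK1 : (1 + K : ℂ) ≠ 0 := by exact_mod_cast (by positivity : 1 + K ≠ 0)
  have hsqrt : ((Real.sqrt (7 + 42*K - K^2) : ℝ) : ℂ) ^ 2 = 7 + 42*K - K^2 := by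
    exact_mod_cast Real.sq_sqrt (by nlinarith : 0 ≤ 7 + 42*K - K^2)
  refine ⟨Matrix.spectrum_fin_two_of_trace_det _ ?_ ?_, ?_, ?_⟩
  · rw [Matrix.trace_fin_two_of]
    push_cast
    field_simp
    ring
  · rw [Matrix.det_fin_two_of]
    push_cast
    rw [← sq_sub_sq, mul_pow, Complex.I_sq, div_pow, div_pow (Complex.ofReal _), hsqrt]
    field_simp
    ring
  · rw [le_div_iff₀ (by positivity)]
    linarith
  · rw [div_lt_div_iff₀ (by positivity) (by norm_num)]
    linarith
end

section
/- Fix K ∈ (0,1] and ε ∈ (0, (1+3K)/(2(1+K))). Let F : ℝ² → ℝ² be F(a,b) = (1 − e^a + 2e^b, (1+7K)/(2K) − ((1+3K)/(2K)) e^a + (1−K) e^b) and x_∞ = (a_∞, b_∞) with a_∞ = log(((1+K)^2+4K)/(1+K)^2), b_∞ = log(2K/(1+K)^2). Then there exist a constant C ≥ 1 and δ > 0 such that every differentiable curve x : [0,∞) → ℝ² satisfying x'(s) = F(x(s)) for all s ≥ 0 and ‖x(0) − x_∞‖ < δ obeys ‖x(s) − x_∞‖ ≤ C e^{−((1+3K)/(2(1+K))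 − ε) s} ‖x(0) − x_∞‖ for all s ≥ 0. In particular, the fixed point x_∞ is asymptotically stable. -/
open Real

/-- A nonnegative function that decays at rate faster than `μ` wherever it is positive and at
most `ρ`, and that starts below `ρ`, is bounded by its initial value times `exp (-μ s)`. -/
theorem le_mul_exp_of_deriv_lt {V V' : ℝ → ℝ} {μ ρ : ℝ} (hμ : 0 ≤ μ)
    (hV : ∀ s ≥ 0, HasDerivAt V (V' s) s)
    (hdecay : ∀ s ≥ 0, 0 < V s → V s ≤ ρ → V' s < -μ * V s)
    (hV0 : 0 ≤ V 0) (hρ : V 0 < ρ) {s : ℝ} (hs : 0 ≤ s) :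
    V s ≤ V 0 * exp (-μ * s) := by
  have key : ∀ η, V 0 < η → η < ρ → V s ≤ η * exp (-μ * s) := by
    intro η h0 h1
    have hη : 0 < η := hV0.trans_lt h0
    have hB : ∀ t, HasDerivAt (fun t => η * exp (-μ * t)) (-μ * (η * exp (-μ * t))) t := by
      intro t
      have h := (((hasDerivAt_id t).const_mul (-μ)).exp).const_mul η
      refine h.congr_deriv ?_
      simp only [id]
      ring
    refine image_le_of_deriv_right_lt_deriv_boundary (a := 0) (b := s) (f := V) (f' := V')
      (fun t ht => (hV t ht.1).continuousAt.continuousWithinAt)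
      (fun t ht => (hV t ht.1).hasDerivWithinAt) (by simpa using h0.le) hB ?_ ⟨hs, le_rfl⟩
    intro t ht hVt
    have hle : V t ≤ ρ := by
      have : exp (-μ * t) ≤ 1 := exp_le_one_iff.2 (by nlinarith [mul_nonneg hμ ht.1])
      rw [hVt]
      nlinarith
    have := hdecay t ht.1 (hVt ▸ by positivity) hle
    rwa [hVt] at this
  have hlim : Filter.Tendsto (fun η => η * exp (-μ * s)) (nhdsWithin (V 0) (Set.Ioi (V 0)))
      (nhds (V 0 * exp (-μ * s))) :=
    (Continuous.tendsto (by fun_prop) _).mono_left nhdsWithin_le_nhds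
  refine ge_of_tendsto hlim ?_
  filter_upwards [Ioo_mem_nhdsGT hρ] with η hη using key η hη.1 hη.2

theorem abs_fst_le_norm (v : ℝ × ℝ) : |v.1| ≤ ‖v‖ := norm_fst_le v

theorem abs_snd_le_norm (v : ℝ × ℝ) : |v.2| ≤ ‖v‖ := norm_snd_le v

theorem quadraticForm_le_mul_norm_sq {α β γ : ℝ} (hα : 0 < α) (hγ : 0 < γ) (v : ℝ × ℝ) :
    α * v.1 ^ 2 + 2 * β * v.1 * v.2 + γ * v.2 ^ 2 ≤ (α + 2 * |β| + γ) * ‖v‖ ^ 2 := by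
  have h1 := abs_fst_le_norm v
  have h2 := abs_snd_le_norm v
  have e1 : v.1 ^ 2 ≤ ‖v‖ ^ 2 := sq_le_sq.2 (by rwa [abs_norm])
  have e2 : v.2 ^ 2 ≤ ‖v‖ ^ 2 := sq_le_sq.2 (by rwa [abs_norm])
  have e3 : β * v.1 * v.2 ≤ |β| * ‖v‖ ^ 2 := by
    calc β * v.1 * v.2 ≤ |β * v.1 * v.2| := le_abs_self _
      _ = |β| * (|v.1| * |v.2|) := by rw [abs_mul, abs_mul, mul_assoc]
      _ ≤ |β| * (‖v‖ * ‖v‖) := by gcongr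
      _ = _ := by ring
  nlinarith [mul_le_mul_of_nonneg_left e1 hα.le, mul_le_mul_of_nonneg_left e2 hγ.le]

theorem mul_norm_sq_le_quadraticForm {α β γ : ℝ} (hα : 0 < α) (hγ : 0 < γ)
    (hdisc : β ^ 2 < α * γ) (v : ℝ × ℝ) :
    (α * γ - β ^ 2) / (α + γ) * ‖v‖ ^ 2 ≤ α * v.1 ^ 2 + 2 * β * v.1 * v.2 + γ * v.2 ^ 2 := by
  have hn : ‖v‖ ^ 2 ≤ v.1 ^ 2 + v.2 ^ 2 := by
    rcases max_cases ‖v.1‖ ‖v.2‖ with h | h <;>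
      · rw [Prod.norm_def, h.1, norm_eq_abs, sq_abs]
        nlinarith [sq_nonneg v.1, sq_nonneg v.2]
  rw [div_mul_eq_mul_div, div_le_iff₀ (by positivity)]
  have := mul_le_mul_of_nonneg_left hn (sub_pos.2 hdisc).le
  nlinarith [sq_nonneg (α * v.1 + β * v.2), sq_nonneg (β * v.1 + γ * v.2)]

/-- Exponential stability of an equilibrium of a planar system from a positive definite quadratic
Lyapunov function whose derivative along the flow is `-2 * l` times itself, up to a cubic error. -/
theorem exists_exponential_decay_of_quadratic_lyapunov {α β γ l ε L : ℝ} (hα : 0 < α)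
    (hγ : 0 < γ) (hdisc : β ^ 2 < α * γ) (hε : 0 < ε) (hεl : ε < l) (hL : 0 < L)
    (F : ℝ × ℝ → ℝ × ℝ) (p : ℝ × ℝ)
    (hF : ∀ y, ‖y - p‖ ≤ 1 →
      2 * (α * (y - p).1 + β * (y - p).2) * (F y).1
        + 2 * (β * (y - p).1 + γ * (y - p).2) * (F y).2 ≤
      -2 * l * (α * (y - p).1 ^ 2 + 2 * β * (y - p).1 * (y - p).2 + γ * (y - p).2 ^ 2)
        + L * ‖y - p‖ ^ 3) :
    ∃ C ≥ (1:ℝ), ∃ δ > (0:ℝ), ∀ x : ℝ → ℝ × ℝ,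
      (∀ s ≥ (0:ℝ), HasDerivAt x (F (x s)) s) → ‖x 0 - p‖ < δ →
        ∀ s ≥ (0:ℝ), ‖x s - p‖ ≤ C * exp (-(l - ε) * s) * ‖x 0 - p‖ := by
  set Q : ℝ × ℝ → ℝ := fun v => α * v.1 ^ 2 + 2 * β * v.1 * v.2 + γ * v.2 ^ 2 with hQ
  obtain ⟨m, hm, hQm⟩ : ∃ m > 0, ∀ v, m * ‖v‖ ^ 2 ≤ Q v :=
    ⟨_, div_pos (sub_pos.2 hdisc) (by positivity), mul_norm_sq_le_quadraticForm hα hγ hdisc⟩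
  obtain ⟨M, hmM, hQM⟩ : ∃ M ≥ m, ∀ v, Q v ≤ M * ‖v‖ ^ 2 := by
    refine ⟨(α + 2 * |β| + γ) + m, by linarith [abs_nonneg β], fun v => ?_⟩
    have := quadraticForm_le_mul_norm_sq (β := β) hα hγ v
    have := mul_nonneg hm.le (sq_nonneg ‖v‖)
    simp only [hQ]
    linarith
  have hM : 0 < M := hm.trans_le hmM
  obtain ⟨r, hr, hr1, hLr⟩ : ∃ r > 0, r ≤ 1 ∧ L * r ≤ ε * m := by
    refine ⟨min 1 (ε * m / L), by positivity, min_le_left _ _, ?_⟩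
    calc L * min 1 (ε * m / L) ≤ L * (ε * m / L) := by gcongr; exact min_le_right _ _
      _ = ε * m := by field_simp
  refine ⟨M / m, (one_le_div hm).2 hmM, r * (m / M), by positivity, fun x hx hx0 s hs => ?_⟩
  have hQ0 : ∀ v, 0 ≤ Q v := fun v => le_trans (by positivity) (hQm v)
  have hV : ∀ t ≥ (0:ℝ), HasDerivAt (fun t => Q (x t - p))
      (2 * (α * (x t - p).1 + β * (x t - p).2) * (F (x t)).1
        + 2 * (β * (x t - p).1 + γ * (x t - p).2) * (F (x t)).2) t := by
    intro t ht
    have h := (hx t ht).sub_const p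
    have h1 : HasDerivAt (fun t => (x t - p).1) (F (x t)).1 t := h.fst
    have h2 : HasDerivAt (fun t => (x t - p).2) (F (x t)).2 t := h.snd
    have h3 := (((h1.pow 2).const_mul α).add ((h1.const_mul (2 * β)).mul h2)).add
      ((h2.pow 2).const_mul γ)
    refine h3.congr_deriv ?_
    simp
    ring
  have hdecay : ∀ t ≥ (0:ℝ), 0 < Q (x t - p) → Q (x t - p) ≤ m * r ^ 2 →
      2 * (α * (x t - p).1 + β * (x t - p).2) * (F (x t)).1
        + 2 * (β * (x t - p).1 + γ * (x t - p).2) * (F (x t)).2 <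
      -(2 * (l - ε)) * Q (x t - p) := by
    intro t _ hpos hle
    have hnr : ‖x t - p‖ ≤ r :=
      le_of_sq_le_sq (le_of_mul_le_mul_left ((hQm _).trans hle) hm) hr.le
    have hcub : L * ‖x t - p‖ ^ 3 ≤ ε * Q (x t - p) := by
      calc L * ‖x t - p‖ ^ 3 = L * ‖x t - p‖ * ‖x t - p‖ ^ 2 := by ring
        _ ≤ L * r * ‖x t - p‖ ^ 2 := by gcongr
        _ ≤ ε * m * ‖x t - p‖ ^ 2 := by gcongr
        _ = ε * (m * ‖x t - p‖ ^ 2) := by ring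
        _ ≤ ε * Q (x t - p) := by gcongr; exact hQm _
    have := hF (x t) (hnr.trans hr1)
    have := mul_pos hε hpos
    simp only [hQ] at *
    linarith
  have hstart : Q (x 0 - p) < m * r ^ 2 := by
    calc Q (x 0 - p) ≤ M * ‖x 0 - p‖ ^ 2 := hQM _
      _ < M * (r * (m / M)) ^ 2 := by gcongr
      _ = m * r ^ 2 * (m / M) := by field_simp
      _ ≤ m * r ^ 2 := mul_le_of_le_one_right (by positivity) ((div_le_one hM).2 hmM)
  have hfin := le_mul_exp_of_deriv_lt (by linarith) hV hdecay (hQ0 _) hstart hs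
  refine le_of_sq_le_sq (le_of_mul_le_mul_left ?_ hm) (by positivity)
  have hexp : exp (-(2 * (l - ε)) * s) = exp (-(l - ε) * s) ^ 2 := by
    rw [← exp_nat_mul]
    congr 1
    push_cast
    ring
  calc m * ‖x s - p‖ ^ 2 ≤ Q (x s - p) := hQm _
    _ ≤ Q (x 0 - p) * exp (-(2 * (l - ε)) * s) := hfin
    _ ≤ M * ‖x 0 - p‖ ^ 2 * exp (-(l - ε) * s) ^ 2 := by
        rw [hexp]; gcongr; exact hQM _
    _ ≤ M / m * (M * ‖x 0 - p‖ ^ 2 * exp (-(l - ε) * s) ^ 2) :=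
        le_mul_of_one_le_left (by positivity) ((one_le_div hm).2 hmM)
    _ = m * (M / m * exp (-(l - ε) * s) * ‖x 0 - p‖) ^ 2 := by field_simp

/-- A remainder of size `N ^ 2` in the vector field contributes at most a multiple of `N ^ 3` to
the derivative of a quadratic Lyapunov function at a point of size `N`. -/
theorem lyapunov_remainder_le {α β γ a b c d u w g h N : ℝ} (hu : |u| ≤ N) (hw : |w| ≤ N)
    (hg : |g| ≤ N ^ 2) (hh : |h| ≤ N ^ 2) :
    2 * (α * u + β * w) * (a * g + b * h) + 2 * (β * u + γ * w) * (c * g + d * h) ≤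
      (2 * (|α| + |β|) * (|a| + |b|) + 2 * (|β| + |γ|) * (|c| + |d|)) * N ^ 3 := by
  have key : ∀ s t x y X : ℝ, |x| ≤ X → |y| ≤ X → |s * x + t * y| ≤ (|s| + |t|) * X := by
    intro s t x y X hx hy
    calc |s * x + t * y| ≤ |s * x| + |t * y| := abs_add_le _ _
      _ = |s| * |x| + |t| * |y| := by rw [abs_mul, abs_mul]
      _ ≤ |s| * X + |t| * X := by gcongr
      _ = _ := by ring
  have hN : 0 ≤ N := (abs_nonneg u).trans hu
  have hprod : ∀ s t a b : ℝ, (s * u + t * w) * (a * g + b * h) ≤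
      ((|s| + |t|) * N) * ((|a| + |b|) * N ^ 2) := fun s t a b =>
    (le_abs_self _).trans ((abs_mul _ _).trans_le
      (mul_le_mul (key s t u w N hu hw) (key a b g h _ hg hh) (abs_nonneg _) (by positivity)))
  nlinarith [hprod α β a b, hprod β γ c d]

/-- Asymptotic stability of the fixed point x_∞ = (a_∞, b_∞) of the planar
autonomous system: there exist C ≥ 1 and δ > 0 such that every solution starting within δ
of x_∞ converges to x_∞ exponentially with rate (1+3K)/(2(1+K)) − ε. -/
theorem asymptotic_stability_linear_eos (K ε : ℝ) (hK : K ∈ Set.Ioc (0:ℝ) 1)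
    (hε : ε ∈ Set.Ioo (0:ℝ) ((1+3*K)/(2*(1+K)))) :
    ∃ C ≥ (1:ℝ), ∃ δ > (0:ℝ),
      ∀ x : ℝ → ℝ × ℝ,
        (∀ s ≥ (0:ℝ), HasDerivAt x
          (1 - Real.exp (x s).1 + 2 * Real.exp (x s).2,
           (1+7*K)/(2*K) - ((1+3*K)/(2*K)) * Real.exp (x s).1
             + (1-K) * Real.exp (x s).2) s) →
        ‖x 0 - (Real.log (((1+K)^2 + 4*K)/(1+K)^2), Real.log (2*K/(1+K)^2))‖ < δ →
        ∀ s ≥ (0:ℝ),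
          ‖x s - (Real.log (((1+K)^2 + 4*K)/(1+K)^2), Real.log (2*K/(1+K)^2))‖ ≤
            C * Real.exp (-((1+3*K)/(2*(1+K)) - ε) * s) *
              ‖x 0 - (Real.log (((1+K)^2 + 4*K)/(1+K)^2), Real.log (2*K/(1+K)^2))‖ := by
  obtain ⟨hK0, hK1⟩ := hK
  set A : ℝ := ((1+K)^2 + 4*K)/(1+K)^2 with hA
  set B : ℝ := 2*K/(1+K)^2 with hB
  set c : ℝ := (1+3*K)/(2*K) with hc
  set l : ℝ := (1+3*K)/(2*(1+K)) with hl
  have hA0 : 0 < A := by positivity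
  have hB0 : 0 < B := by positivity
  have hc0 : 0 < c := by positivity
  have htrace : (1 - K) * B = A - 2 * l := by
    rw [hA, hB, hl]; field_simp; ring
  have hdet : 2 * c * A * B = 2 * A + (1 - K) * A * B := by
    rw [hA, hB, hc]; field_simp; ring
  have hfix₁ : 1 - A + 2 * B = 0 := by
    rw [hA, hB]; field_simp; ring
  have hfix₂ : (1+7*K)/(2*K) - c * A + (1-K) * B = 0 := by
    rw [hA, hB, hc]; field_simp; ring
  have hosc : l ^ 2 < 2 * A := by
    rw [hA, hl, div_pow, ← mul_div_assoc, div_lt_div_iff₀ (by positivity) (by positivity)]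
    have : (1 + 3 * K) ^ 2 < 8 * ((1 + K) ^ 2 + 4 * K) := by nlinarith
    nlinarith [mul_lt_mul_of_pos_right this (by positivity : 0 < (1 + K) ^ 2)]
  refine exists_exponential_decay_of_quadratic_lyapunov (α := c * A) (β := l - A) (γ := 2 * B)
    (L := 2 * (|c * A| + |l - A|) * (|-A| + |2 * B|)
      + 2 * (|l - A| + |2 * B|) * (|-(c * A)| + |(1 - K) * B|))
    (by positivity) (by positivity) ?_ hε.1 hε.2 (by positivity)
    (fun y => (1 - exp y.1 + 2 * exp y.2, (1+7*K)/(2*K) - c * exp y.1 + (1-K) * exp y.2))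
    (log A, log B) ?_
  · nlinarith
  intro y hy
  have hu := abs_fst_le_norm (y - (log A, log B))
  have hw := abs_snd_le_norm (y - (log A, log B))
  have hsq : ∀ z : ℝ, |z| ≤ ‖y - (log A, log B)‖ →
      |exp z - 1 - z| ≤ ‖y - (log A, log B)‖ ^ 2 := fun z hz =>
    (abs_exp_sub_one_sub_id_le (hz.trans hy)).trans (sq_le_sq.2 (by rwa [abs_norm]))
  have hrem := lyapunov_remainder_le (α := c * A) (β := l - A) (γ := 2 * B) (a := -A)
    (b := 2 * B) (c := -(c * A)) (d := (1 - K) * B) hu hw (hsq _ hu) (hsq _ hw)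
  set u := (y - (log A, log B)).1 with hudef
  set w := (y - (log A, log B)).2 with hwdef
  have hea : exp y.1 = A * exp u := by
    rw [show y.1 = log A + u by simp [hudef], exp_add, exp_log hA0]
  have heb : exp y.2 = B * exp w := by
    rw [show y.2 = log B + w by simp [hwdef], exp_add, exp_log hB0]
  refine le_trans (le_of_eq ?_) (add_le_add_right hrem _)
  simp only [hea, heb]
  rw [show 1 - A * exp u + 2 * (B * exp w) = -A * (exp u - 1) + 2 * B * (exp w - 1) by
      linear_combination hfix₁,
    show (1+7*K)/(2*K) - c * (A * exp u) + (1-K) * (B * exp w) =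
      -(c * A) * (exp u - 1) + (1 - K) * B * (exp w - 1) by linear_combination hfix₂, htrace]
  ring
end

section
/- Fix K ∈ (0,1] and ρ₀ > 0. Let m, ρ : (0,∞) → ℝ be a smooth solution of the system m'(r) = 4π r^2 ρ(r), ρ'(r) = -((1+K) ρ(r)/(r - 2 m(r))) · (4π r^2 ρ(r) + m(r)/(r K)), with ρ(r) > 0 and r - 2m(r) > 0 for all r > 0, such that m(r) → 0 and ρ(r) → ρ₀ as r → 0⁺. Then for every ε > 0, as r → ∞ one has m(r) = (2K/((1+K)^2+4K))·r + O(r^{(1−K)/(2(1+K)) + ε}) and ρ(r) = (K/(2π((1+K)^2+4K)))·r^{−2} + O(r^{−(5+7K)/(2(1+K)) + ε}). -/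
open Real Filter Asymptotics

/-- The Lotka–Volterra entropy `z - s - s log (z / s)` of `z` relative to the equilibrium `s`. -/
noncomputable def lvEntropy (s z : ℝ) : ℝ := z - s - s * (log z - log s)

theorem lvEntropy_le {s z : ℝ} (hs : 0 < s) (hz : 0 < z) :
    lvEntropy s z ≤ (z - s) ^ 2 / z := by
  have h := Real.one_sub_inv_le_log_of_pos (div_pos hz hs)
  rw [log_div hz.ne' hs.ne', inv_div] at h
  have h' := mul_le_mul_of_nonneg_left h hs.le
  have e : (z - s) ^ 2 / z = z - s - s * (1 - s / z) := by field_simp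
  rw [e, lvEntropy]
  linarith

theorem le_lvEntropy {s z : ℝ} (hs : 0 < s) (hz : 0 < z) :
    (z - s) ^ 2 / (2 * (z + s)) ≤ lvEntropy s z := by
  obtain ⟨a, ha, rfl⟩ : ∃ a, 0 < a ∧ a ^ 2 = z := ⟨√z, sqrt_pos.2 hz, sq_sqrt hz.le⟩
  obtain ⟨b, hb, rfl⟩ : ∃ b, 0 < b ∧ b ^ 2 = s := ⟨√s, sqrt_pos.2 hs, sq_sqrt hs.le⟩
  have h := Real.log_le_sub_one_of_pos (div_pos ha hb)
  rw [log_div ha.ne' hb.ne'] at h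
  have h' := mul_le_mul_of_nonneg_left h (by positivity : (0:ℝ) ≤ 2 * b ^ 2)
  have e : 2 * b ^ 2 * (a / b - 1) = 2 * b * a - 2 * b ^ 2 := by field_simp
  have h1 : (a ^ 2 - b ^ 2) ^ 2 / (2 * (a ^ 2 + b ^ 2)) ≤ (a - b) ^ 2 := by
    rw [div_le_iff₀ (by positivity)]
    nlinarith [mul_nonneg (sq_nonneg (a - b)) (sq_nonneg (a - b))]
  rw [lvEntropy, log_pow, log_pow]
  push_cast
  nlinarith

theorem lvEntropy_nonneg {s z : ℝ} (hs : 0 < s) (hz : 0 < z) : 0 ≤ lvEntropy s z :=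
  le_trans (by positivity) (le_lvEntropy hs hz)

theorem le_of_lvEntropy_le {s z M : ℝ} (hs : 0 < s) (hz : 0 < z) (h : lvEntropy s z ≤ M) :
    z ≤ 3 * s + 4 * M := by
  have hM := (lvEntropy_nonneg hs hz).trans h
  have h1 := (le_lvEntropy hs hz).trans h
  rw [div_le_iff₀ (by positivity)] at h1
  by_contra! hlt
  nlinarith [mul_pos (by linarith : 0 < z - s - 4 * M) (by linarith : 0 < z + s),
    mul_pos (by linarith : 0 < z - 3 * s) (by linarith : 0 < z - s)]

theorem exp_le_of_lvEntropy_le {s z M : ℝ} (hs : 0 < s) (hz : 0 < z) (h : lvEntropy s z ≤ M) :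
    s * exp (-1 - M / s) ≤ z := by
  rw [← log_le_log_iff (by positivity) hz, log_mul hs.ne' (exp_ne_zero _), log_exp]
  rw [lvEntropy] at h
  have : s * (-1 - M / s) ≤ s * (log z - log s) := by
    have e : s * (-1 - M / s) = -s - M := by field_simp
    linarith
  linarith [le_of_mul_le_mul_left this hs]

theorem hasDerivAt_lvEntropy {s z' t : ℝ} {z : ℝ → ℝ} (hz : HasDerivAt z z' t) (h : z t ≠ 0) :
    HasDerivAt (fun τ => lvEntropy s (z τ)) ((1 - s / z t) * z') t := by
  have := (hz.sub_const s).sub (((hz.log h).sub_const (log s)).const_mul s)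
  refine this.congr_deriv ?_
  ring

theorem tendsto_of_tendsto_lvEntropy {s : ℝ} {z : ℝ → ℝ} (hs : 0 < s) (hz : ∀ t, 0 < z t)
    (h : Tendsto (fun t => lvEntropy s (z t)) atTop (nhds 0)) : Tendsto z atTop (nhds s) := by
  have hsq : Tendsto (fun t => (z t - s) ^ 2) atTop (nhds 0) := by
    have hb : Tendsto (fun t => 2 * (4 * s + 4 * 1) * lvEntropy s (z t)) atTop (nhds 0) := by
      simpa using h.const_mul (2 * (4 * s + 4 * 1))
    refine squeeze_zero' (.of_forall fun t => sq_nonneg _) ?_ hb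
    filter_upwards [h.eventually_le_const one_pos] with t ht
    have h1 := le_of_lvEntropy_le hs (hz t) ht
    have h2 := le_lvEntropy hs (hz t)
    rw [div_le_iff₀ (by linarith [hz t])] at h2
    nlinarith [lvEntropy_nonneg hs (hz t)]
  have habs : Tendsto (fun t => |z t - s|) atTop (nhds 0) := by
    simpa [sqrt_sq_eq_abs] using hsq.sqrt
  have := (tendsto_zero_iff_abs_tendsto_zero _).2 habs
  simpa using this.add_const s

theorem le_mul_exp_of_deriv_le {f f' : ℝ → ℝ} {k T : ℝ}
    (hf : ∀ t, HasDerivAt f (f' t) t) (hle : ∀ t ≥ T, f' t ≤ k * f t) :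
    ∀ t ≥ T, f t ≤ f T * exp (-k * T) * exp (k * t) := by
  have hd : ∀ t, HasDerivAt (fun t => f t * exp (-k * t))
      ((f' t - k * f t) * exp (-k * t)) t := fun t => by
    have h1 : HasDerivAt (fun t => exp (-k * t)) (exp (-k * t) * (-k)) t := by
      simpa using ((hasDerivAt_id t).const_mul (-k)).exp
    exact ((hf t).mul h1).congr_deriv (by ring)
  have hanti : AntitoneOn (fun t => f t * exp (-k * t)) (Set.Ici T) := by
    refine antitoneOn_of_hasDerivWithinAt_nonpos (convex_Ici T)
      (fun t _ => (hd t).continuousAt.continuousWithinAt)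
      (fun t _ => (hd t).hasDerivWithinAt) fun t ht => ?_
    rw [interior_Ici] at ht
    exact mul_nonpos_of_nonpos_of_nonneg (by linarith [hle t (le_of_lt ht)]) (exp_pos _).le
  intro t ht
  have h := mul_le_mul_of_nonneg_right (hanti Set.self_mem_Ici ht ht) (exp_pos (k * t)).le
  have e : exp (-k * t) * exp (k * t) = 1 := by rw [← exp_add]; simp
  calc f t = f t * exp (-k * t) * exp (k * t) := by rw [mul_assoc, e, mul_one]
    _ ≤ _ := h

/-- Global convergence to the interior equilibrium `(u, y) = (p, q)` of a planar
Lotka–Volterra predator–prey system with self-limitation, after a change of time by `u`. -/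
theorem tendsto_equilibrium {u y : ℝ → ℝ} {B k p q : ℝ} (hB : 0 < B) (hk : 0 < k)
    (hp : 0 < p) (hq : 0 < q) (hu : ∀ t, 0 < u t) (hy : ∀ t, 0 < y t)
    (hu' : ∀ t, HasDerivAt u (-(u t - p) - 2 * (y t - q)) t)
    (hy' : ∀ t, HasDerivAt y (y t * (B * (u t - p) - k * (y t - q)) / u t) t) :
    Tendsto u atTop (nhds p) ∧ Tendsto y atTop (nhds q) := by
  set V : ℝ → ℝ := fun t => B / 2 * lvEntropy p (u t) + lvEntropy q (y t)
  have hV : ∀ t, V t = B / 2 * lvEntropy p (u t) + lvEntropy q (y t) := fun _ => rfl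
  set V' : ℝ → ℝ := fun t => -(B / 2 * (u t - p) ^ 2 + k * (y t - q) ^ 2) / u t with hV'
  have hVd : ∀ t, HasDerivAt V (V' t) t := fun t => by
    have hut := (hu t).ne'
    have hyt := (hy t).ne'
    refine (((hasDerivAt_lvEntropy (hu' t) hut).const_mul (B / 2)).add
      (hasDerivAt_lvEntropy (hy' t) hyt)).congr_deriv ?_
    simp only [hV']
    field_simp
    ring
  have hUn : ∀ t, 0 ≤ lvEntropy p (u t) := fun t => lvEntropy_nonneg hp (hu t)
  have hYn : ∀ t, 0 ≤ lvEntropy q (y t) := fun t => lvEntropy_nonneg hq (hy t)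
  have hV0 : ∀ t ≥ 0, V t ≤ V 0 := by
    have := le_mul_exp_of_deriv_le (k := 0) (T := 0) hVd fun t _ => by
      rw [zero_mul]
      exact div_nonpos_of_nonpos_of_nonneg
        (neg_nonpos.2 (by positivity)) (hu t).le
    simpa using this
  have hV0n : 0 ≤ V 0 := by
    have := hUn 0
    have := hYn 0
    positivity
  set U := 3 * p + 4 * (V 0 / (B / 2)) with hU
  set Y := q * exp (-1 - V 0 / q) with hY
  have hUpos : 0 < U := by positivity
  have hYpos : 0 < Y := by positivity
  have huU : ∀ t ≥ 0, u t ≤ U := fun t ht => by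
    refine le_of_lvEntropy_le hp (hu t) ?_
    rw [le_div_iff₀ (by positivity)]
    linarith [hV0 t ht, hYn t, hV t]
  have hyY : ∀ t ≥ 0, Y ≤ y t := fun t ht => by
    refine exp_le_of_lvEntropy_le hq (hy t) ?_
    have := mul_nonneg (half_pos hB).le (hUn t)
    linarith [hV0 t ht, hV t]
  set c := min 1 (k * Y / U) with hc
  have hcpos : 0 < c := lt_min one_pos (by positivity)
  have hdecay := le_mul_exp_of_deriv_le (k := -c) (T := 0) hVd fun t ht => by
    have hut := hu t
    have hyt := hy t
    have h1 : c * lvEntropy p (u t) ≤ (u t - p) ^ 2 / u t :=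
      (mul_le_of_le_one_left (hUn t) (min_le_left _ _)).trans (lvEntropy_le hp hut)
    have h2 : c * lvEntropy q (y t) ≤ k * (y t - q) ^ 2 / u t := by
      have hcu : c ≤ k * y t / u t := (min_le_right _ _).trans (by
        have := huU t ht
        have := hyY t ht
        gcongr)
      calc c * lvEntropy q (y t) ≤ (k * y t / u t) * ((y t - q) ^ 2 / y t) :=
            mul_le_mul hcu (lvEntropy_le hq hyt) (hYn t) (by positivity)
        _ = _ := by field_simp
    have h3 := mul_le_mul_of_nonneg_left h1 (half_pos hB).le
    have e : V' t = -(B / 2 * ((u t - p) ^ 2 / u t) + k * (y t - q) ^ 2 / u t) := by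
      simp only [hV']; ring
    rw [e, hV]
    linarith
  have hexp : Tendsto (fun t => V 0 * exp (- -c * 0) * exp (-c * t)) atTop (nhds 0) := by
    have : Tendsto (fun t : ℝ => exp (-c * t)) atTop (nhds 0) :=
      tendsto_exp_atBot.comp (tendsto_id.const_mul_atTop_of_neg (neg_neg_of_pos hcpos))
    simpa using this.const_mul (V 0 * exp (- -c * 0))
  constructor
  · refine tendsto_of_tendsto_lvEntropy hp hu ?_
    have hlim := hexp.const_mul (B / 2)⁻¹
    rw [mul_zero (B / 2)⁻¹] at hlim
    refine squeeze_zero' (.of_forall hUn) ?_ hlim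
    filter_upwards [eventually_ge_atTop 0] with t ht
    rw [inv_mul_eq_div, le_div_iff₀ (by positivity)]
    linarith [hdecay t ht, hYn t, hV t]
  · refine tendsto_of_tendsto_lvEntropy hq hy ?_
    refine squeeze_zero' (.of_forall hYn) ?_ hexp
    filter_upwards [eventually_ge_atTop 0] with t ht
    have := mul_nonneg (half_pos hB).le (hUn t)
    linarith [hdecay t ht, hV t]

/-- Decay rate of a perturbation of the linear system with matrix `[[-1, 1], [-a, -b]]`, in a
range of parameters where its eigenvalues are complex: half the trace, up to `ε`. -/
theorem exists_abs_le_exp {ξ η h : ℝ → ℝ} {a b : ℝ} (ha : a ∈ Set.Icc 1 4) (hb : b ∈ Set.Icc 0 1)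
    (hξ : ∀ t, HasDerivAt ξ (η t - ξ t) t)
    (hη : ∀ t, HasDerivAt η (h t * (-a * ξ t - b * η t)) t)
    (hh : Tendsto h atTop (nhds 1)) {ε : ℝ} (hε : 0 < ε) :
    ∃ C T, ∀ t ≥ T, |ξ t| ≤ C * exp ((-(1 + b) / 2 + ε) * t) ∧
      |η t| ≤ C * exp ((-(1 + b) / 2 + ε) * t) := by
  obtain ⟨ha1, ha4⟩ := ha
  obtain ⟨hb0, hb1⟩ := hb
  set Q : ℝ → ℝ := fun t => η t ^ 2 - (1 - b) * (ξ t * η t) + a * ξ t ^ 2 with hQ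
  have hQge : ∀ t, ξ t ^ 2 + η t ^ 2 ≤ 2 * Q t := fun t => by
    simp only [hQ]
    nlinarith [mul_nonneg hb0 (sq_nonneg (ξ t + η t)),
      mul_nonneg (sub_nonneg.2 hb1) (sq_nonneg (ξ t - η t)),
      mul_nonneg (sub_nonneg.2 ha1) (sq_nonneg (ξ t)), sq_nonneg (ξ t), sq_nonneg (η t),
      mul_nonneg hb0 (sq_nonneg (ξ t)), mul_nonneg hb0 (sq_nonneg (η t))]
  have hQd : ∀ t, HasDerivAt Q (-(1 + b) * Q t +
      (h t - 1) * ((2 * η t - (1 - b) * ξ t) * (-a * ξ t - b * η t))) t := fun t => by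
    refine ((((hη t).pow 2).sub (((hξ t).mul (hη t)).const_mul (1 - b))).add
      (((hξ t).pow 2).const_mul a)).congr_deriv ?_
    simp only [hQ]
    push_cast
    ring
  have hR : ∀ t, |(2 * η t - (1 - b) * ξ t) * (-a * ξ t - b * η t)| ≤ 18 * Q t := fun t => by
    have h1 : |2 * η t - (1 - b) * ξ t| ≤ 2 * |η t| + |ξ t| := by
      refine (abs_sub _ _).trans ?_
      rw [abs_mul, abs_mul, abs_two, abs_of_nonneg (by linarith : 0 ≤ 1 - b)]
      nlinarith [abs_nonneg (ξ t)]
    have h2 : |-a * ξ t - b * η t| ≤ 4 * |ξ t| + |η t| := by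
      refine (abs_sub _ _).trans ?_
      rw [abs_mul, abs_mul, abs_neg, abs_of_nonneg hb0, abs_of_nonneg (by linarith : 0 ≤ a)]
      nlinarith [abs_nonneg (ξ t), abs_nonneg (η t)]
    rw [abs_mul]
    have h3 := mul_le_mul h1 h2 (abs_nonneg _) (by positivity)
    nlinarith [hQge t, sq_abs (ξ t), sq_abs (η t), sq_nonneg (|ξ t| - |η t|)]
  obtain ⟨T, hT⟩ : ∃ T, ∀ t ≥ T, |h t - 1| < ε / 9 :=
    eventually_atTop.1 (by
      simpa [Real.dist_eq] using hh.eventually (Metric.ball_mem_nhds 1 (by positivity : 0 < ε / 9)))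
  have hdecay := le_mul_exp_of_deriv_le (k := -(1 + b) + 2 * ε) (T := T) hQd fun t ht => by
    have h1 := mul_le_mul (hT t ht).le (hR t) (abs_nonneg _) (by positivity)
    rw [← abs_mul] at h1
    linarith [le_abs_self ((h t - 1) * ((2 * η t - (1 - b) * ξ t) * (-a * ξ t - b * η t)))]
  set D := Q T * exp (-(-(1 + b) + 2 * ε) * T) with hD
  have hDn : 0 ≤ D := mul_nonneg (by nlinarith [hQge T]) (exp_pos _).le
  have key : ∀ t ≥ T, ∀ z, z ^ 2 ≤ 2 * Q t →
      |z| ≤ √(2 * D) * exp ((-(1 + b) / 2 + ε) * t) := fun t ht z hz => by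
    refine abs_le_of_sq_le_sq ?_ (mul_nonneg (sqrt_nonneg _) (exp_pos _).le)
    rw [mul_pow, sq_sqrt (by positivity), ← exp_nat_mul]
    have e : ((2 : ℕ) : ℝ) * ((-(1 + b) / 2 + ε) * t) = (-(1 + b) + 2 * ε) * t := by
      push_cast; ring
    rw [e]
    linarith [hdecay t ht]
  exact ⟨√(2 * D), T, fun t ht => ⟨key t ht _ (by nlinarith [hQge t]),
    key t ht _ (by nlinarith [hQge t])⟩⟩

/-- Asymptotics at infinity of regular solutions of the static spherically
symmetric Einstein–Euler system with linear equation of state p = Kρ and central density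
ρ₀ > 0: for every ε > 0, m(r) = (2K/((1+K)²+4K))r + O(r^{(1−K)/(2(1+K))+ε}) and
ρ(r) = (K/(2π((1+K)²+4K)))r^{−2} + O(r^{−(5+7K)/(2(1+K))+ε}) as r → ∞. -/
theorem asymptotics_linear_eos (K ρ₀ : ℝ) (hK : K ∈ Set.Ioc (0:ℝ) 1) (hρ₀ : 0 < ρ₀)
    (m ρ : ℝ → ℝ)
    (hm_smooth : ContDiffOn ℝ (⊤ : ℕ∞) m (Set.Ioi 0))
    (hρ_smooth : ContDiffOn ℝ (⊤ : ℕ∞) ρ (Set.Ioi 0))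
    (hρpos : ∀ r > (0:ℝ), 0 < ρ r)
    (hhor : ∀ r > (0:ℝ), 0 < r - 2 * m r)
    (hm : ∀ r > (0:ℝ), HasDerivAt m (4 * π * r^2 * ρ r) r)
    (hρ : ∀ r > (0:ℝ), HasDerivAt ρ
      (-((1+K) * ρ r / (r - 2 * m r)) * (4 * π * r^2 * ρ r + m r / (r * K))) r)
    (hm0 : Filter.Tendsto m (nhdsWithin 0 (Set.Ioi 0)) (nhds 0))
    (hρ0 : Filter.Tendsto ρ (nhdsWithin 0 (Set.Ioi 0)) (nhds ρ₀)) :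
    ∀ ε > (0:ℝ),
      (fun r : ℝ => m r - (2*K/((1+K)^2 + 4*K)) * r) =O[atTop]
        (fun r : ℝ => r ^ ((1-K)/(2*(1+K)) + ε)) ∧
      (fun r : ℝ => ρ r - (K/(2*π*((1+K)^2 + 4*K))) * r ^ (-2:ℝ)) =O[atTop]
        (fun r : ℝ => r ^ (-(5+7*K)/(2*(1+K)) + ε)) := by
  intro ε hε
  obtain ⟨hK0, hK1⟩ := hK
  have hKne := hK0.ne'
  set N := (1 + K) ^ 2 + 4 * K with hN
  have hNpos : 0 < N := by positivity
  set s := 2 * K / N with hs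
  have hspos : 0 < s := by positivity
  set p := (1 + K) ^ 2 / N with hp
  have hppos : 0 < p := by positivity
  have hps : 1 - 2 * s = p := by rw [hs, hp]; field_simp; rw [hN]; ring
  set X : ℝ → ℝ := fun t => m (exp t) / exp t with hX
  set Y : ℝ → ℝ := fun t => 4 * π * exp t ^ 2 * ρ (exp t) with hY
  have hupos : ∀ t, 0 < 1 - 2 * X t := fun t => by
    have e : 1 - 2 * X t = (exp t - 2 * m (exp t)) / exp t := by
      simp only [hX]; field_simp
    rw [e]
    exact div_pos (hhor _ (exp_pos t)) (exp_pos t)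
  have hYpos : ∀ t, 0 < Y t := fun t => by
    have := hρpos _ (exp_pos t)
    positivity
  have hXd : ∀ t, HasDerivAt X (Y t - X t) t := fun t => by
    refine (((hm _ (exp_pos t)).comp t (Real.hasDerivAt_exp t)).div
      (Real.hasDerivAt_exp t) (exp_ne_zero t)).congr_deriv ?_
    simp only [hX, hY, Function.comp]
    field_simp
  have hYd : ∀ t, HasDerivAt Y
      (Y t * ((4 + (1 + K) / K) * (s - X t) - (1 + K) * (Y t - s)) / (1 - 2 * X t)) t :=
      fun t => by
    have hd := ((((Real.hasDerivAt_exp t).pow 2).const_mul (4 * π)).mul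
      ((hρ _ (exp_pos t)).comp t (Real.hasDerivAt_exp t)))
    refine hd.congr_deriv ?_
    have hu := (hupos t).ne'
    have e1 : exp t - 2 * m (exp t) = exp t * (1 - 2 * X t) := by
      simp only [hX]; field_simp
    have e2 : m (exp t) / (exp t * K) = X t / K := by
      simp only [hX]; field_simp
    have e3 : (4 + (1 + K) / K) * s + (1 + K) * s = 2 := by
      rw [hs]; field_simp; rw [hN]; ring
    have e4 : (4 + (1 + K) / K) * (s - X t) - (1 + K) * (Y t - s) =
        2 * (1 - 2 * X t) - (1 + K) * (Y t + X t / K) := by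
      linear_combination e3
    simp only [Function.comp, Pi.pow_apply]
    rw [e1, e2, e4]
    have hE : 4 * π * exp t ^ 2 * ρ (exp t) = Y t := rfl
    rw [hE]
    have hE' := exp_ne_zero t
    field_simp
    simp only [hY]
    push_cast
    ring
  have hud : ∀ t, HasDerivAt (fun t => 1 - 2 * X t)
      (-((1 - 2 * X t) - p) - 2 * (Y t - s)) t := fun t =>
    (((hXd t).const_mul 2).const_sub 1).congr_deriv (by rw [← hps]; ring)
  obtain ⟨hulim, hYlim⟩ := tendsto_equilibrium (B := (4 + (1 + K) / K) / 2) (k := 1 + K)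
    (by positivity) (by positivity) hppos hspos hupos hYpos hud fun t =>
      (hYd t).congr_deriv (by rw [← hps]; ring)
  have hh : Tendsto (fun t => Y t / s * (p / (1 - 2 * X t))) atTop (nhds 1) := by
    have := (hYlim.div_const s).mul ((tendsto_const_nhds (x := p)).div hulim hppos.ne')
    rwa [div_self hspos.ne', div_self hppos.ne', one_mul] at this
  have hsp : s / p = 2 * K / (1 + K) ^ 2 := by rw [hs, hp]; field_simp
  set b := 2 * K / (1 + K) with hb
  set a := 2 / (1 + K) + 8 * K / (1 + K) ^ 2 with ha
  have ha_mem : a ∈ Set.Icc 1 4 := by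
    have h1 : 1 ≤ 2 / (1 + K) := by rw [le_div_iff₀ (by positivity)]; linarith
    have h2 : 2 / (1 + K) ≤ 2 := by rw [div_le_iff₀ (by positivity)]; linarith
    have h3 : 0 ≤ 8 * K / (1 + K) ^ 2 := by positivity
    have h4 : 8 * K / (1 + K) ^ 2 ≤ 2 := by
      rw [div_le_iff₀ (by positivity)]; nlinarith [sq_nonneg (1 - K)]
    exact ⟨by linarith, by linarith⟩
  have hb_mem : b ∈ Set.Icc 0 1 :=
    ⟨by positivity, by rw [hb, div_le_iff₀ (by positivity)]; linarith⟩
  obtain ⟨C, T, hCT⟩ := exists_abs_le_exp (ξ := fun t => X t - s) (η := fun t => Y t - s)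
    (h := fun t => Y t / s * (p / (1 - 2 * X t))) ha_mem hb_mem
    (fun t => ((hXd t).sub_const s).congr_deriv (by ring))
    (fun t => ((hYd t).sub_const s).congr_deriv (by
      have hu := (hupos t).ne'
      have ea : a = (4 + (1 + K) / K) * (s / p) := by rw [hsp, ha]; field_simp; ring
      have eb : b = (1 + K) * (s / p) := by rw [hsp, hb]; field_simp
      rw [ea, eb]
      field_simp
      ring)) hh hε
  have hbound : ∀ r > 0, log r ≥ T →
      |m r / r - s| ≤ C * r ^ (-(1 + b) / 2 + ε) ∧
      |4 * π * r ^ 2 * ρ r - s| ≤ C * r ^ (-(1 + b) / 2 + ε) := fun r hr hT => by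
    have := hCT (log r) hT
    simp only [hX, hY, exp_log hr] at this
    rwa [rpow_def_of_pos hr, mul_comm (log r)]
  have hlarge : ∀ᶠ r : ℝ in atTop, 0 < r ∧ log r ≥ T :=
    (eventually_gt_atTop 0).and (tendsto_log_atTop.eventually_ge_atTop T)
  constructor
  · refine IsBigO.of_bound C (hlarge.mono fun r ⟨hr, hrT⟩ => ?_)
    have e : m r - s * r = r * (m r / r - s) := by field_simp
    have e' : (1 - K) / (2 * (1 + K)) + ε = 1 + (-(1 + b) / 2 + ε) := by
      rw [hb]; field_simp; ring
    rw [e, e', rpow_add hr, rpow_one, norm_mul, norm_mul, norm_eq_abs, norm_eq_abs, norm_eq_abs,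
      abs_of_pos hr, abs_of_pos (rpow_pos_of_pos hr _)]
    have := mul_le_mul_of_nonneg_left (hbound r hr hrT).1 hr.le
    linarith
  · refine IsBigO.of_bound (C / (4 * π)) (hlarge.mono fun r ⟨hr, hrT⟩ => ?_)
    have e2 : r ^ (-2 : ℝ) = (r ^ 2)⁻¹ := by
      rw [rpow_neg hr.le]; norm_cast
    have e : ρ r - K / (2 * π * N) * r ^ (-2 : ℝ) =
        r ^ (-2 : ℝ) * ((4 * π * r ^ 2 * ρ r - s) / (4 * π)) := by
      rw [e2, hs]; field_simp; ring
    have e' : -(5 + 7 * K) / (2 * (1 + K)) + ε = -2 + (-(1 + b) / 2 + ε) := by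
      rw [hb]; field_simp; ring
    rw [e, e', rpow_add hr, norm_mul, norm_mul, norm_div, norm_eq_abs, norm_eq_abs, norm_eq_abs,
      norm_eq_abs, abs_of_pos (rpow_pos_of_pos hr (-2)), abs_of_pos (rpow_pos_of_pos hr _),
      abs_of_pos (by positivity : 0 < 4 * π)]
    have h1 := div_le_div_of_nonneg_right (hbound r hr hrT).2 (by positivity : 0 ≤ 4 * π)
    have h2 := mul_le_mul_of_nonneg_left h1 (rpow_pos_of_pos hr (-2)).le
    refine h2.trans_eq ?_
    ring
end

section
/- Fix K ∈ (0,1] and ρ₀ > 0, and set α = 4K/((1+K)^2+4K). Let m, ρ : (0,∞) → ℝ be a smooth solution of the system m'(r) = 4π r^2 ρ(r), ρ'(r) = -((1+K) ρ(r)/(r - 2 m(r))) · (4π r^2 ρ(r) + m(r)/(r K)), with ρ(r) > 0 and r - 2m(r) > 0 for all r > 0, such that m(r) → 0 and ρ(r) → ρ₀ as r → 0⁺. Then, as r → ∞, 2m(r)/r − α = o(r^{−1/2}) and ρ'(r)/ρ(r) = o(r^{−1/2}). -/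
open Real Filter Asymptotics Topology

/-- A Barbalat-type lemma: if `G ≥ 0` dissipates at least at rate `g f²` and `f` is Lipschitz,
then `f → 0`. -/
lemma tendsto_zero_of_dissipation {G f G' f' : ℝ → ℝ} {g C : ℝ} (hg : 0 < g)
    (hG : ∀ t ≥ 0, HasDerivAt G (G' t) t) (hf : ∀ t ≥ 0, HasDerivAt f (f' t) t)
    (hdiss : ∀ t ≥ 0, G' t ≤ -g * f t ^ 2) (hC : ∀ t ≥ 0, |f' t| ≤ C)
    (hpos : ∀ t ≥ 0, 0 ≤ G t) : Tendsto f atTop (𝓝 0) := by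
  have hanti : AntitoneOn G (Set.Ici 0) := by
    refine antitoneOn_of_hasDerivWithinAt_nonpos (f' := G') (convex_Ici 0)
      (fun t ht => (hG t ht).continuousAt.continuousWithinAt) ?_ ?_
    · intro t ht
      exact (hG t (interior_subset ht)).hasDerivWithinAt
    · intro t ht
      have := hdiss t (interior_subset ht)
      nlinarith [sq_nonneg (f t)]
  obtain ⟨l, hl⟩ : ∃ l, Tendsto G atTop (𝓝 l) := by
    have hanti' : Antitone fun t => G (max t 0) := fun a b hab =>
      hanti (Set.mem_Ici.2 (le_max_right _ _)) (Set.mem_Ici.2 (le_max_right _ _))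
        (max_le_max_right 0 hab)
    have hbdd : BddBelow (Set.range fun t => G (max t 0)) :=
      ⟨0, by rintro _ ⟨t, rfl⟩; exact hpos _ (le_max_right _ _)⟩
    refine ⟨_, (tendsto_atTop_ciInf hanti' hbdd).congr' ?_⟩
    filter_upwards [eventually_ge_atTop 0] with t ht
    rw [max_eq_left ht]
  have hCnn : 0 ≤ C := (abs_nonneg _).trans (hC 0 le_rfl)
  rw [Metric.tendsto_nhds]
  intro ε hε
  set h : ℝ := ε / (2 * (C + 1)) with hh
  have hhpos : 0 < h := by positivity
  have hCh : C * h ≤ ε / 2 := by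
    have : (C + 1) * h = ε / 2 := by rw [hh]; field_simp
    nlinarith
  have hdrop : Tendsto (fun t => G t - G (t + h)) atTop (𝓝 0) := by
    simpa using hl.sub (hl.comp (tendsto_atTop_add_const_right atTop h tendsto_id))
  have hη : 0 < g * (ε / 2) ^ 2 * h := by positivity
  filter_upwards [hdrop.eventually_lt_const hη, eventually_ge_atTop 0] with t ht ht0
  rw [Real.dist_eq, sub_zero]
  by_contra! hft
  have hbig : ∀ s ∈ Set.Icc t (t + h), ε / 2 ≤ |f s| := by
    intro s hs
    have hmv := (convex_Icc t (t + h)).norm_image_sub_le_of_norm_hasDerivWithin_le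
      (f := f) (f' := f') (C := C)
      (fun x hx => (hf x (ht0.trans hx.1)).hasDerivWithinAt)
      (fun x hx => hC x (ht0.trans hx.1))
      (Set.left_mem_Icc.2 (by linarith)) hs
    rw [Real.norm_eq_abs, Real.norm_eq_abs, abs_of_nonneg (sub_nonneg.2 hs.1)] at hmv
    have h1 : C * (s - t) ≤ C * h := mul_le_mul_of_nonneg_left (by linarith [hs.2]) hCnn
    have h2 := abs_sub_abs_le_abs_sub (f t) (f s)
    rw [abs_sub_comm] at h2
    linarith
  have hdec : AntitoneOn (fun s => G s + g * (ε / 2) ^ 2 * s) (Set.Icc t (t + h)) := by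
    have hd : ∀ s ∈ Set.Icc t (t + h), HasDerivAt (fun s => G s + g * (ε / 2) ^ 2 * s)
        (G' s + g * (ε / 2) ^ 2) s := fun s hs =>
      ((hG s (ht0.trans hs.1)).add
        ((hasDerivAt_id s).const_mul (g * (ε / 2) ^ 2))).congr_deriv (by simp)
    refine antitoneOn_of_hasDerivWithinAt_nonpos
      (f' := fun s => G' s + g * (ε / 2) ^ 2) (convex_Icc _ _)
      (fun s hs => (hd s hs).continuousAt.continuousWithinAt)
      (fun s hs => (hd s (interior_subset hs)).hasDerivWithinAt) ?_
    intro s hs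
    have hs' := interior_subset hs
    have h1 := hdiss s (ht0.trans hs'.1)
    have h2 : (ε / 2) ^ 2 ≤ f s ^ 2 := by
      rw [← sq_abs (f s)]
      exact pow_le_pow_left₀ (by positivity) (hbig s hs') 2
    nlinarith
  have := hdec (Set.left_mem_Icc.2 (by linarith)) (Set.right_mem_Icc.2 (by linarith))
    (by linarith : t ≤ t + h)
  simp only at this
  nlinarith

/-- If `z²` is bounded by an energy that decays at an exponential rate `1 + ε > 1`,
then `z = o(exp (-t / 2))`. -/
lemma isLittleO_exp_of_energy_le {E E' z : ℝ → ℝ} {ε T : ℝ} (hε : 0 < ε)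
    (hE : ∀ t ≥ T, HasDerivAt E (E' t) t) (hE' : ∀ t ≥ T, E' t ≤ -(1 + ε) * E t)
    (hz : ∀ t ≥ T, z t ^ 2 ≤ E t) : z =o[atTop] fun t => exp (-t / 2) := by
  have hanti : AntitoneOn (fun t => E t * exp ((1 + ε) * t)) (Set.Ici T) := by
    have hd : ∀ t ≥ T, HasDerivAt (fun t => E t * exp ((1 + ε) * t))
        ((E' t + (1 + ε) * E t) * exp ((1 + ε) * t)) t := fun t ht =>
      ((hE t ht).mul ((hasDerivAt_id t).const_mul (1 + ε)).exp).congr_deriv (by simp; ring)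
    refine antitoneOn_of_hasDerivWithinAt_nonpos
      (f' := fun t => (E' t + (1 + ε) * E t) * exp ((1 + ε) * t)) (convex_Ici T)
      (fun t ht => (hd t ht).continuousAt.continuousWithinAt)
      (fun t ht => (hd t (interior_subset ht)).hasDerivWithinAt) fun t ht => ?_
    exact mul_nonpos_of_nonpos_of_nonneg (by linarith [hE' t (interior_subset ht)]) (exp_pos _).le
  have hsq : Tendsto (fun t => (z t / exp (-t / 2)) ^ 2) atTop (𝓝 0) := by
    have hlim : Tendsto (fun t => E T * exp ((1 + ε) * T) * exp (-(ε * t))) atTop (𝓝 0) := by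
      simpa using (tendsto_exp_neg_atTop_nhds_zero.comp
        (tendsto_id.const_mul_atTop hε)).const_mul (E T * exp ((1 + ε) * T))
    refine tendsto_of_tendsto_of_tendsto_of_le_of_le' tendsto_const_nhds hlim
      (Eventually.of_forall fun t => sq_nonneg _) ?_
    filter_upwards [eventually_ge_atTop T] with t ht
    have h1 : E t * exp ((1 + ε) * t) ≤ E T * exp ((1 + ε) * T) :=
      hanti (Set.mem_Ici.2 le_rfl) ht ht
    have h2 : (z t / exp (-t / 2)) ^ 2 = z t ^ 2 * exp t := by
      rw [div_pow, ← exp_nat_mul, div_eq_mul_inv, ← exp_neg]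
      congr 2
      push_cast
      ring
    have h3 : exp t = exp ((1 + ε) * t) * exp (-(ε * t)) := by
      rw [← exp_add]; congr 1; ring
    rw [h2, h3, ← mul_assoc]
    refine mul_le_mul_of_nonneg_right ?_ (exp_pos _).le
    exact (mul_le_mul_of_nonneg_right (hz t ht) (exp_pos _).le).trans h1
  rw [isLittleO_iff_tendsto fun t ht => absurd ht (exp_pos _).ne',
    tendsto_zero_iff_abs_tendsto_zero]
  simpa [sqrt_sq_eq_abs, Function.comp_def] using hsq.sqrt

/-- The logarithm of the monotone function of the autonomous system satisfied by
`w = 1 - 2m/r` and `P = 8πr²p`. -/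
noncomputable def logMonotone (K w P : ℝ) : ℝ :=
  2 * log (1 + P + (1 + 5 * K) / (1 + K) * w) - log w
    - 4 * K ^ 2 / ((1 + K) * (1 + 5 * K)) * log P

/-- `w`, `P` solve the autonomous system obtained from the Einstein–Euler system through
`t = log r`, `w = 1 - 2m/r`, `P = 8πKr²ρ`. -/
structure IsAutonomousSolution (K : ℝ) (w P : ℝ → ℝ) : Prop where
  deriv_w : ∀ t, HasDerivAt w (1 - w t - P t / K) t
  deriv_P : ∀ t, HasDerivAt P
    (-((1 + K) / (2 * K) * P t * (1 + P t - (1 + 5 * K) / (1 + K) * w t) / w t)) t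
  w_pos : ∀ t, 0 < w t
  w_lt_one : ∀ t, w t < 1
  P_pos : ∀ t, 0 < P t

namespace IsAutonomousSolution

variable {K : ℝ} {w P : ℝ → ℝ}

lemma hasDerivAt_logMonotone (h : IsAutonomousSolution K w P) (hK : 0 < K) (t : ℝ) :
    HasDerivAt (fun t => logMonotone K (w t) (P t))
      (-((1 + 3 * K) / (1 + 5 * K) * (1 + P t - (1 + 5 * K) / (1 + K) * w t) ^ 2 /
        (w t * (1 + P t + (1 + 5 * K) / (1 + K) * w t)))) t := by
  have hw := h.w_pos t
  have hP := h.P_pos t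
  have hS : 0 < 1 + P t + (1 + 5 * K) / (1 + K) * w t := by positivity
  have hd := (((((h.deriv_P t).const_add 1).add
    ((h.deriv_w t).const_mul ((1 + 5 * K) / (1 + K)))).log hS.ne').const_mul 2).sub
    ((h.deriv_w t).log hw.ne') |>.sub
    (((h.deriv_P t).log hP.ne').const_mul (4 * K ^ 2 / ((1 + K) * (1 + 5 * K))))
  refine hd.congr_deriv ?_
  have hS' : 0 < (1 + P t) * (1 + K) + (1 + 5 * K) * w t := by positivity
  have hSeq : 1 + P t + (1 + 5 * K) / (1 + K) * w t
      = ((1 + P t) * (1 + K) + (1 + 5 * K) * w t) / (1 + K) := by field_simp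
  simp only [Pi.add_apply, hSeq]
  field_simp
  ring

lemma logMonotone_bounds (h : IsAutonomousSolution K w P) (hK : 0 < K) (t : ℝ) :
    0 ≤ logMonotone K (w t) (P t) ∧ -log (w t) ≤ logMonotone K (w t) (P t) ∧
      log (1 + P t) ≤ logMonotone K (w t) (P t) := by
  have hw := h.w_pos t
  have hP := h.P_pos t
  have hq0 : 0 ≤ 4 * K ^ 2 / ((1 + K) * (1 + 5 * K)) := by positivity
  have hq1 : 4 * K ^ 2 / ((1 + K) * (1 + 5 * K)) ≤ 1 := by
    rw [div_le_one (by positivity)]; nlinarith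
  have hlw : log (w t) ≤ 0 := log_nonpos hw.le (h.w_lt_one t).le
  have hl1 : 0 ≤ log (1 + P t) := log_nonneg (by linarith)
  have hlP : log (P t) ≤ log (1 + P t) := log_le_log hP (by linarith)
  have hlS : log (1 + P t) ≤ log (1 + P t + (1 + 5 * K) / (1 + K) * w t) :=
    log_le_log (by positivity) (le_add_of_nonneg_right (by positivity))
  have hqP : 4 * K ^ 2 / ((1 + K) * (1 + 5 * K)) * log (P t) ≤ log (1 + P t) := by
    nlinarith
  unfold logMonotone
  refine ⟨?_, ?_, ?_⟩ <;> linarith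

lemma exists_bounds (h : IsAutonomousSolution K w P) (hK : 0 < K) :
    ∃ a b : ℝ, 0 < a ∧ 0 < b ∧ ∀ t ≥ 0, a ≤ w t ∧ P t ≤ b := by
  set Λ := logMonotone K (w 0) (P 0)
  have hanti : Antitone fun t => logMonotone K (w t) (P t) := by
    refine antitone_of_hasDerivAt_nonpos (h.hasDerivAt_logMonotone hK) fun t => ?_
    have hw := h.w_pos t
    have hP := h.P_pos t
    exact neg_nonpos.2 (by positivity)
  refine ⟨exp (-Λ), exp Λ, exp_pos _, exp_pos _, fun t ht => ?_⟩
  have hΛ : logMonotone K (w t) (P t) ≤ Λ := hanti ht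
  obtain ⟨-, h1, h2⟩ := h.logMonotone_bounds hK t
  have hP := h.P_pos t
  constructor
  · rw [← le_log_iff_exp_le (h.w_pos t)]; linarith
  · have := (log_le_iff_le_exp (by linarith : 0 < 1 + P t)).1 (h2.trans hΛ)
    linarith

lemma tendsto_equilibrium (h : IsAutonomousSolution K w P) (hK : 0 < K) :
    Tendsto (fun t => w t - (1 + K) ^ 2 / ((1 + K) ^ 2 + 4 * K)) atTop (𝓝 0) ∧
      Tendsto (fun t => 1 + P t - (1 + 5 * K) / (1 + K) * w t) atTop (𝓝 0) := by
  obtain ⟨a, b, ha, hb, hab⟩ := h.exists_bounds hK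
  set c := (1 + 5 * K) / (1 + K) with hc
  set w₀ := (1 + K) ^ 2 / ((1 + K) ^ 2 + 4 * K) with hw₀
  set κ := 1 + c / K with hκ
  have hcpos : 0 < c := by positivity
  have hκpos : 0 < κ := by positivity
  set S := 1 + b + c with hS
  have hSpos : 0 < S := by positivity
  set g := (1 + 3 * K) / (1 + 5 * K) / S with hg
  have hgpos : 0 < g := by positivity
  set A := (1 + 1 / (κ * K ^ 2)) / g with hA
  have hApos : 0 < A := by positivity
  have hz : ∀ t, HasDerivAt (fun t => w t - w₀) (1 - w t - P t / K) t := fun t =>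
    (h.deriv_w t).sub_const w₀
  have hN : ∀ t, HasDerivAt (fun t => 1 + P t - c * w t)
      (-((1 + K) / (2 * K) * P t * (1 + P t - c * w t) / w t) - c * (1 - w t - P t / K)) t :=
    fun t => ((h.deriv_P t).const_add 1).sub ((h.deriv_w t).const_mul c)
  have hw' : ∀ t, 1 - w t - P t / K = -κ * (w t - w₀) - (1 + P t - c * w t) / K := by
    intro t
    simp only [hκ, hc, hw₀]
    field_simp
    ring
  have hG : ∀ t, HasDerivAt (fun t => (w t - w₀) ^ 2 + A * logMonotone K (w t) (P t))
      (2 * (w t - w₀) * (1 - w t - P t / K) + A * (-((1 + 3 * K) / (1 + 5 * K) *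
        (1 + P t - c * w t) ^ 2 / (w t * (1 + P t + c * w t))))) t := by
    intro t
    refine (((hz t).pow 2).add ((h.hasDerivAt_logMonotone hK t).const_mul A)).congr_deriv ?_
    simp [hc]
  have hGpos : ∀ t ≥ 0, 0 ≤ (w t - w₀) ^ 2 + A * logMonotone K (w t) (P t) := fun t _ =>
    add_nonneg (sq_nonneg _) (mul_nonneg hApos.le (h.logMonotone_bounds hK t).1)
  have hdiss : ∀ t ≥ 0, 2 * (w t - w₀) * (1 - w t - P t / K) + A * (-((1 + 3 * K) / (1 + 5 * K) *
        (1 + P t - c * w t) ^ 2 / (w t * (1 + P t + c * w t))))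
      ≤ -κ * (w t - w₀) ^ 2 - (1 + P t - c * w t) ^ 2 := by
    intro t ht
    obtain ⟨-, hPb⟩ := hab t ht
    have hw := h.w_pos t
    have hw1 := h.w_lt_one t
    have hP := h.P_pos t
    rw [hw' t]
    set z := w t - w₀
    set N := 1 + P t - c * w t
    have hwS : w t * (1 + P t + c * w t) ≤ S := by
      have h1 : c * w t ≤ c := by nlinarith
      have h2 : 0 < 1 + P t + c * w t := by positivity
      nlinarith
    have hL : g * N ^ 2 ≤ (1 + 3 * K) / (1 + 5 * K) * N ^ 2 / (w t * (1 + P t + c * w t)) := by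
      have : g * N ^ 2 = (1 + 3 * K) / (1 + 5 * K) * N ^ 2 / S := by rw [hg]; ring
      rw [this]
      exact div_le_div_of_nonneg_left (by positivity) (by positivity) hwS
    have hAL := mul_le_mul_of_nonneg_left hL hApos.le
    have hAg : A * (g * N ^ 2) = N ^ 2 + N ^ 2 / (κ * K ^ 2) := by
      rw [hA]; field_simp
    have hsq : 0 ≤ (κ * z + N / K) ^ 2 / κ := by positivity
    have hexp : (κ * z + N / K) ^ 2 / κ = κ * z ^ 2 + 2 * z * (N / K) + N ^ 2 / (κ * K ^ 2) := by
      field_simp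
      ring
    nlinarith
  have hw'b : ∀ t ≥ 0, |1 - w t - P t / K| ≤ 1 + b / K := by
    intro t ht
    have hw := h.w_pos t
    have hw1 := h.w_lt_one t
    have hP := h.P_pos t
    have h1 : P t / K ≤ b / K := div_le_div_of_nonneg_right (hab t ht).2 hK.le
    have h2 : 0 < P t / K := by positivity
    rw [abs_le]; constructor <;> linarith
  have hNb : ∀ t ≥ 0, |-((1 + K) / (2 * K) * P t * (1 + P t - c * w t) / w t)
      - c * (1 - w t - P t / K)| ≤ (1 + K) / (2 * K) * b * S / a + c * (1 + b / K) := by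
    intro t ht
    have hw := h.w_pos t
    have hw1 := h.w_lt_one t
    have hP := h.P_pos t
    obtain ⟨haw, hPb⟩ := hab t ht
    have hNS : |1 + P t - c * w t| ≤ S := by
      have h1 : c * w t ≤ c := by nlinarith
      have h2 : 0 < c * w t := by positivity
      rw [abs_le]; constructor <;> linarith
    refine (abs_sub _ _).trans (add_le_add ?_ ?_)
    · rw [abs_neg, abs_div, abs_mul, abs_of_pos hw,
        abs_of_pos (by positivity : 0 < (1 + K) / (2 * K) * P t)]
      gcongr
    · rw [abs_mul, abs_of_pos hcpos]
      exact mul_le_mul_of_nonneg_left (hw'b t ht) hcpos.le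
  constructor
  · refine tendsto_zero_of_dissipation hκpos (fun t _ => hG t) (fun t _ => hz t) (fun t ht => ?_)
      hw'b hGpos
    have := hdiss t ht
    nlinarith [sq_nonneg (1 + P t - c * w t)]
  · refine tendsto_zero_of_dissipation one_pos (fun t _ => hG t) (fun t _ => hN t) (fun t ht => ?_)
      hNb hGpos
    have := hdiss t ht
    nlinarith [mul_nonneg hκpos.le (sq_nonneg (w t - w₀))]

/-- Energy estimate at the equilibrium, which is a stable spiral with decay rate
`(1 + 3K) / (2(1 + K)) > 1 / 2`. -/
lemma isLittleO_sub_equilibrium (h : IsAutonomousSolution K w P) (hK : 0 < K) (hK1 : K ≤ 1) :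
    (fun t => w t - (1 + K) ^ 2 / ((1 + K) ^ 2 + 4 * K)) =o[atTop] fun t => exp (-t / 2) := by
  obtain ⟨hz0, hN0⟩ := h.tendsto_equilibrium hK
  set c := (1 + 5 * K) / (1 + K) with hc
  set w₀ := (1 + K) ^ 2 / ((1 + K) ^ 2 + 4 * K) with hw₀
  set κ := 1 + c / K with hκ
  set τ := (1 + 3 * K) / (1 + K) with hτ
  set β := 2 + 8 * K / (1 + K) ^ 2 - τ ^ 2 / 4 with hβ
  set ε := (τ - 1) / 2 with hε
  have hτ1 : 1 < τ := by rw [hτ, lt_div_iff₀ (by positivity)]; linarith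
  have hτ2 : τ ≤ 2 := by rw [hτ, div_le_iff₀ (by positivity)]; linarith
  have hβ1 : 1 ≤ β := by
    have : 0 ≤ 8 * K / (1 + K) ^ 2 := by positivity
    nlinarith
  have hεpos : 0 < ε := by rw [hε]; linarith
  have hw₀pos : 0 < w₀ := by positivity
  set δ : ℝ → ℝ := fun t => (1 + K) / (2 * K) / K * (P t / w t - 4 * K ^ 2 / (1 + K) ^ 2) with hδ
  set C := 1 + 2 * K ^ 2 * (1 + (κ - τ / 2) ^ 2) with hC
  have hCpos : 0 < C := by positivity
  have hδ0 : Tendsto δ atTop (𝓝 0) := by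
    have hwt : Tendsto w atTop (𝓝 w₀) := by simpa using hz0.add_const w₀
    have hPt : Tendsto P atTop (𝓝 (c * w₀ - 1)) := by
      have := (hN0.add (hwt.const_mul c)).sub_const 1
      refine (this.congr fun t => ?_).trans_eq ?_
      · ring
      · rw [zero_add]
    have := ((hPt.div hwt hw₀pos.ne').sub_const (4 * K ^ 2 / (1 + K) ^ 2)).const_mul
      ((1 + K) / (2 * K) / K)
    refine this.trans_eq ?_
    congr 1
    simp only [hc, hw₀]
    field_simp
    ring
  set y : ℝ → ℝ := fun t => 1 - w t - P t / K + τ / 2 * (w t - w₀) with hy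
  set E : ℝ → ℝ := fun t => y t ^ 2 + β * (w t - w₀) ^ 2 with hE
  have hyd : ∀ t, HasDerivAt y
      (-(τ / 2) * y t - β * (w t - w₀) + δ t * (1 + P t - c * w t)) t := by
    intro t
    have hw := h.w_pos t
    refine ((((h.deriv_w t).const_sub 1).sub ((h.deriv_P t).div_const K)).add
      (((h.deriv_w t).sub_const w₀).const_mul (τ / 2))).congr_deriv ?_
    simp only [hy, hδ, hβ, hτ, hc, hw₀]
    field_simp
    ring
  have hEd : ∀ t, HasDerivAt E (-τ * E t + δ t * (2 * y t * (1 + P t - c * w t))) t := by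
    intro t
    refine (((hyd t).pow 2).add ((((h.deriv_w t).sub_const w₀).pow 2).const_mul β)).congr_deriv ?_
    have : 1 - w t - P t / K = y t - τ / 2 * (w t - w₀) := by simp only [hy]; ring
    rw [this]
    simp only [hE]
    push_cast
    ring
  have hzE : ∀ t, (w t - w₀) ^ 2 ≤ E t := fun t => by
    simp only [hE]
    nlinarith [sq_nonneg (y t), sq_nonneg (w t - w₀)]
  have hcross : ∀ t, |2 * y t * (1 + P t - c * w t)| ≤ C * E t := by
    intro t
    have hNy : 1 + P t - c * w t = -K * (y t + (κ - τ / 2) * (w t - w₀)) := by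
      simp only [hy, hκ, hc, hw₀]
      field_simp
      ring
    have hyE : y t ^ 2 ≤ E t := by
      simp only [hE]; nlinarith [sq_nonneg (w t - w₀)]
    have h1 : |2 * y t * (1 + P t - c * w t)| ≤ y t ^ 2 + (1 + P t - c * w t) ^ 2 := by
      generalize y t = Y
      generalize 1 + P t - c * w t = N
      rw [abs_le]
      constructor <;> linarith [sq_nonneg (Y + N), sq_nonneg (Y - N), add_sq Y N, sub_sq Y N]
    have h2 : (1 + P t - c * w t) ^ 2
        ≤ 2 * K ^ 2 * (y t ^ 2 + (κ - τ / 2) ^ 2 * (w t - w₀) ^ 2) := by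
      rw [hNy]
      generalize y t = Y
      generalize κ - τ / 2 = p
      generalize w t - w₀ = Z
      linarith [mul_nonneg (sq_nonneg K) (sq_nonneg (Y - p * Z))]
    have h3 : (κ - τ / 2) ^ 2 * (w t - w₀) ^ 2 ≤ (κ - τ / 2) ^ 2 * E t :=
      mul_le_mul_of_nonneg_left (hzE t) (sq_nonneg _)
    have h4 := mul_le_mul_of_nonneg_left (add_le_add hyE h3) (by positivity : 0 ≤ 2 * K ^ 2)
    calc _ ≤ _ := h1
      _ ≤ E t + 2 * K ^ 2 * (E t + (κ - τ / 2) ^ 2 * E t) := by linarith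
      _ = C * E t := by rw [hC]; ring
  obtain ⟨T, hT⟩ : ∃ T, ∀ t ≥ T, |δ t| < ε / C := by
    have := hδ0.abs
    rw [abs_zero] at this
    exact eventually_atTop.1 (this.eventually_lt_const (div_pos hεpos hCpos))
  refine isLittleO_exp_of_energy_le hεpos (fun t _ => hEd t) (fun t ht => ?_) (fun t _ => hzE t)
    (T := T)
  have h1 : δ t * (2 * y t * (1 + P t - c * w t)) ≤ ε * E t := by
    calc _ ≤ |δ t * (2 * y t * (1 + P t - c * w t))| := le_abs_self _
      _ = |δ t| * |2 * y t * (1 + P t - c * w t)| := abs_mul _ _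
      _ ≤ ε / C * (C * E t) :=
        mul_le_mul (hT t ht).le (hcross t) (abs_nonneg _) (by positivity)
      _ = ε * E t := by field_simp
  have h2 : τ = 1 + 2 * ε := by rw [hε]; ring
  rw [h2]
  linarith

end IsAutonomousSolution

/-- For regular solutions of the static spherically symmetric Einstein–Euler
system with linear equation of state p = Kρ and central density ρ₀ > 0, setting
α = 4K/((1+K)²+4K), one has 2m(r)/r − α = o(r^{−1/2}) and ρ'(r)/ρ(r) = o(r^{−1/2})
as r → ∞. -/
theorem decay_conditions_linear_eos (K ρ₀ : ℝ) (hK : K ∈ Set.Ioc (0:ℝ) 1) (hρ₀ : 0 < ρ₀)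
    (m ρ : ℝ → ℝ)
    (hm_smooth : ContDiffOn ℝ (⊤ : ℕ∞) m (Set.Ioi 0))
    (hρ_smooth : ContDiffOn ℝ (⊤ : ℕ∞) ρ (Set.Ioi 0))
    (hρpos : ∀ r > (0:ℝ), 0 < ρ r)
    (hhor : ∀ r > (0:ℝ), 0 < r - 2 * m r)
    (hm : ∀ r > (0:ℝ), HasDerivAt m (4 * π * r^2 * ρ r) r)
    (hρ : ∀ r > (0:ℝ), HasDerivAt ρ
      (-((1+K) * ρ r / (r - 2 * m r)) * (4 * π * r^2 * ρ r + m r / (r * K))) r)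
    (hm0 : Filter.Tendsto m (nhdsWithin 0 (Set.Ioi 0)) (nhds 0))
    (hρ0 : Filter.Tendsto ρ (nhdsWithin 0 (Set.Ioi 0)) (nhds ρ₀)) :
    (fun r : ℝ => 2 * m r / r - 4*K/((1+K)^2 + 4*K)) =o[atTop]
      (fun r : ℝ => r ^ (-(1:ℝ)/2)) ∧
    (fun r : ℝ => deriv ρ r / ρ r) =o[atTop] (fun r : ℝ => r ^ (-(1:ℝ)/2)) := by
  obtain ⟨hK0, hK1⟩ := hK
  have hm_pos : ∀ r > (0 : ℝ), 0 < m r := by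
    have hmono : StrictMonoOn m (Set.Ioi 0) := by
      refine strictMonoOn_of_deriv_pos (convex_Ioi 0)
        (fun r hr => (hm r hr).continuousAt.continuousWithinAt) fun r hr => ?_
      rw [interior_Ioi] at hr
      have hr' : 0 < r := hr
      rw [(hm r hr).deriv]
      have := hρpos r hr
      positivity
    intro r hr
    have h1 : 0 ≤ m (r / 2) := by
      refine le_of_tendsto hm0 ?_
      filter_upwards [Ioo_mem_nhdsGT (half_pos hr)] with s hs
      exact (hmono hs.1 (Set.mem_Ioi.2 (half_pos hr)) hs.2).le
    exact h1.trans_lt (hmono (Set.mem_Ioi.2 (half_pos hr)) hr (half_lt_self hr))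
  have hsol : IsAutonomousSolution K (fun t => 1 - 2 * m (exp t) / exp t)
      (fun t => K * (8 * π * exp t ^ 2 * ρ (exp t))) := by
    refine ⟨fun t => ?_, fun t => ?_, fun t => ?_, fun t => ?_, fun t => ?_⟩
    · have he := exp_pos t
      refine (((((hm _ he).comp t (Real.hasDerivAt_exp t)).const_mul 2).div
        (Real.hasDerivAt_exp t) he.ne').const_sub 1).congr_deriv ?_
      simp only [Function.comp_apply]
      field_simp
      ring
    · have he := exp_pos t
      have hh := hhor _ he
      refine ((((((Real.hasDerivAt_exp t).pow 2).const_mul (8 * π)).mul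
        ((hρ _ he).comp t (Real.hasDerivAt_exp t)))).const_mul K).congr_deriv ?_
      have hw : 1 - 2 * m (exp t) / exp t = (exp t - 2 * m (exp t)) / exp t := by field_simp
      simp only [Function.comp_apply, Pi.pow_apply, hw]
      push_cast
      field_simp
      ring
    · have he := exp_pos t
      have hw : 1 - 2 * m (exp t) / exp t = (exp t - 2 * m (exp t)) / exp t := by field_simp
      rw [hw]
      exact div_pos (hhor _ he) he
    · have := hm_pos _ (exp_pos t)
      have : 0 < 2 * m (exp t) / exp t := by positivity
      linarith
    · have := hρpos _ (exp_pos t)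
      positivity
  constructor
  · have h := ((hsol.isLittleO_sub_equilibrium hK0 hK1).comp_tendsto tendsto_log_atTop).neg_left
    refine h.congr' ?_ ?_
    · filter_upwards [eventually_gt_atTop 0] with r hr
      simp only [Function.comp_apply, exp_log hr]
      field_simp
      ring
    · filter_upwards [eventually_gt_atTop 0] with r hr
      simp only [Function.comp_apply]
      rw [rpow_def_of_pos hr]
      congr 1
      ring
  · obtain ⟨a, b, ha, hb, hab⟩ := hsol.exists_bounds hK0
    have hO : (fun r : ℝ => deriv ρ r / ρ r) =O[atTop] fun r : ℝ => r ^ (-1 : ℝ) := by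
      refine IsBigO.of_bound ((1 + K) / (2 * K) * (b + 1) / a) ?_
      filter_upwards [eventually_ge_atTop 1] with r hr
      have hr0 : 0 < r := by linarith
      obtain ⟨h1, h2⟩ := hab (log r) (log_nonneg hr)
      simp only [exp_log hr0] at h1 h2
      have hρr := hρpos r hr0
      have hmr := hm_pos r hr0
      have hh := hhor r hr0
      have hw : 1 - 2 * m r / r = (r - 2 * m r) / r := by field_simp
      have hmb : 2 * m r / r ≤ 1 := by rw [div_le_one hr0]; linarith
      have hwpos : 0 < 1 - 2 * m r / r := ha.trans_le h1
      have heq : deriv ρ r / ρ r = -((1 + K) / (2 * K) *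
          (K * (8 * π * r ^ 2 * ρ r) + 2 * m r / r) / (1 - 2 * m r / r) * r⁻¹) := by
        rw [(hρ r hr0).deriv, hw]
        field_simp
        ring
      rw [heq, norm_neg, rpow_neg_one, norm_mul]
      refine mul_le_mul_of_nonneg_right ?_ (norm_nonneg _)
      rw [Real.norm_of_nonneg (by positivity)]
      gcongr
    refine hO.trans_isLittleO (isLittleO_of_tendsto' ?_ ?_)
    · filter_upwards [eventually_gt_atTop 0] with r hr h
      exact absurd h (rpow_pos_of_pos hr _).ne'
    · refine (tendsto_rpow_neg_atTop (by norm_num : (0 : ℝ) < 1 / 2)).congr' ?_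
      filter_upwards [eventually_gt_atTop 0] with r hr
      rw [← rpow_sub hr]
      norm_num
end

section
/- Fix α ∈ [0,1) and let a, b : (0,∞) → ℝ be differentiable. For x ∈ ℝ³ \ {0} define h_{kl}(x) = b(|x|) h^α_{kl}(x) + (a(|x|) − b(|x|)) x_k x_l/|x|², where h^α_{kl}(x) = (1−α)δ_{kl} + α x_k x_l/|x|², and let Γ^m_{jk}(x) = (α/|x|²)(δ_{jk} x_m − x_m x_j x_k/|x|²) be the Christoffel symbols of h^α. Then the covariant derivative ∇^α_j h_{kl}(x) := ∂_j h_{kl}(x) − Σ_m Γ^m_{jk}(x) h_{ml}(x) − Σ_m Γ^m_{jl}(x) h_{mk}(x) equals (1−α) b'(|x|) (x_j/|x|) δ_{kl} + (a'(|x|) − (1−α) b'(|x|)) x_j x_k x_l/|x|³ + ((1−α)/|x|²)(a(|x|) − b(|x|)) (δ_{jk} x_l + δ_{jl} x_k − 2 x_j x_k x_l/|x|²). -/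
noncomputable section

/-- Kronecker delta on `Fin 3`. -/
def kron (i j : Fin 3) : ℝ := if i = j then 1 else 0

/-- h^α_{ij}(x) = (1−α)δ_{ij} + α x_i x_j/|x|². -/
def halpha (α : ℝ) (x : EuclideanSpace ℝ (Fin 3)) (i j : Fin 3) : ℝ :=
  (1 - α) * kron i j + α * x i * x j / ‖x‖^2

/-- Christoffel symbols of h^α: Γ^m_{jk}(x) = (α/|x|²)(δ_{jk} x_m − x_m x_j x_k/|x|²). -/
def Gammaalpha (α : ℝ) (x : EuclideanSpace ℝ (Fin 3)) (m j k : Fin 3) : ℝ :=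
  (α/‖x‖^2) * (kron j k * x m - x m * x j * x k / ‖x‖^2)

/-- Cartesian expression of the spherically symmetric metric
a(ξ)dξ² + b(ξ)(1−α)ξ²dΩ²: h_{kl}(x) = b(|x|)h^α_{kl}(x) + (a(|x|)−b(|x|)) x_k x_l/|x|². -/
def hmet (α : ℝ) (a b : ℝ → ℝ) (x : EuclideanSpace ℝ (Fin 3)) (k l : Fin 3) : ℝ :=
  b ‖x‖ * halpha α x k l + (a ‖x‖ - b ‖x‖) * x k * x l / ‖x‖^2

/-- The j-th partial derivative of a function on ℝ³. -/
def pd (j : Fin 3) (f : EuclideanSpace ℝ (Fin 3) → ℝ) (x : EuclideanSpace ℝ (Fin 3)) : ℝ :=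
  fderiv ℝ f x (EuclideanSpace.single j 1)

theorem hasFDerivAt_norm_of_ne_zero {x : EuclideanSpace ℝ (Fin 3)} (hx : x ≠ 0) :
    HasFDerivAt (fun y : EuclideanSpace ℝ (Fin 3) => ‖y‖) (‖x‖⁻¹ • innerSL ℝ x) x := by
  have h := ((hasStrictFDerivAt_norm_sq x).hasFDerivAt).sqrt
    (pow_ne_zero 2 (norm_ne_zero_iff.mpr hx))
  have hr : ‖x‖ ≠ 0 := norm_ne_zero_iff.mpr hx
  simp only [Real.sqrt_sq (norm_nonneg _)] at h
  refine h.congr_fderiv ?_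
  ext v
  simp
  field_simp

theorem hasFDerivAt_coord (x : EuclideanSpace ℝ (Fin 3)) (i : Fin 3) :
    HasFDerivAt (fun y : EuclideanSpace ℝ (Fin 3) => y i)
      (EuclideanSpace.proj i : EuclideanSpace ℝ (Fin 3) →L[ℝ] ℝ) x :=
  (EuclideanSpace.proj i : EuclideanSpace ℝ (Fin 3) →L[ℝ] ℝ).hasFDerivAt

theorem pd_hmet (α : ℝ) {a b : ℝ → ℝ} {x : EuclideanSpace ℝ (Fin 3)} (hx : x ≠ 0)
    (ha : DifferentiableAt ℝ a ‖x‖) (hb : DifferentiableAt ℝ b ‖x‖) (j k l : Fin 3) :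
    pd j (fun y => hmet α a b y k l) x =
      (1 - α) * deriv b ‖x‖ * (x j / ‖x‖) * kron k l
        + (deriv a ‖x‖ - (1 - α) * deriv b ‖x‖) * x j * x k * x l / ‖x‖ ^ 3
        + (a ‖x‖ - (1 - α) * b ‖x‖) / ‖x‖ ^ 2
            * (kron j k * x l + kron j l * x k - 2 * x j * x k * x l / ‖x‖ ^ 2) := by
  have hr : ‖x‖ ≠ 0 := norm_ne_zero_iff.mpr hx
  have hn := hasFDerivAt_norm_of_ne_zero hx
  have hA := ha.hasDerivAt.comp_hasFDerivAt x hn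
  have hB := hb.hasDerivAt.comp_hasFDerivAt x hn
  have hk := hasFDerivAt_coord x k
  have hl := hasFDerivAt_coord x l
  have hinv := (hasDerivAt_inv (pow_ne_zero 2 hr)).comp_hasFDerivAt x (hn.pow 2)
  have h := (hB.mul (((hk.const_mul α).mul hl |>.mul hinv).const_add
    ((1 - α) * kron k l))).add ((((hA.sub hB).mul hk).mul hl).mul hinv)
  have hpd : pd j (fun y => hmet α a b y k l) x = _ :=
    congrArg (fun L : EuclideanSpace ℝ (Fin 3) →L[ℝ] ℝ => L (EuclideanSpace.single j 1)) h.fderiv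
  have hcoord (i : Fin 3) : (EuclideanSpace.single j (1 : ℝ)) i = kron j i := by
    simp [kron, eq_comm]
  have hinner : inner ℝ x (EuclideanSpace.single j (1 : ℝ)) = x j := by
    simp [EuclideanSpace.inner_single_right]
  rw [hpd]
  simp only [add_apply, sub_apply,
    smul_apply, innerSL_apply_apply, PiLp.proj_apply, smul_eq_mul,
    Function.comp_apply, Pi.mul_apply, Pi.sub_apply, hcoord, hinner, nsmul_eq_mul]
  field_simp
  ring

theorem sum_coord_mul_hmet (α : ℝ) (a b : ℝ → ℝ) {x : EuclideanSpace ℝ (Fin 3)} (hx : x ≠ 0)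
    (l : Fin 3) : ∑ m : Fin 3, x m * hmet α a b x m l = a ‖x‖ * x l := by
  have hr : ‖x‖ ≠ 0 := norm_ne_zero_iff.mpr hx
  have hsq : ∑ m : Fin 3, x m ^ 2 = ‖x‖ ^ 2 := (EuclideanSpace.real_norm_sq_eq x).symm
  have hkron : ∑ m : Fin 3, x m * kron m l = x l := by simp [kron]
  calc ∑ m : Fin 3, x m * hmet α a b x m l
      = (1 - α) * b ‖x‖ * ∑ m : Fin 3, x m * kron m l
        + (a ‖x‖ - (1 - α) * b ‖x‖) * x l / ‖x‖ ^ 2 * ∑ m : Fin 3, x m ^ 2 := by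
        simp only [Finset.mul_sum, ← Finset.sum_add_distrib]
        refine Finset.sum_congr rfl fun m _ => ?_
        unfold hmet halpha
        ring
    _ = a ‖x‖ * x l := by
        rw [hkron, hsq]
        field_simp
        ring

theorem sum_Gammaalpha_mul_hmet (α : ℝ) (a b : ℝ → ℝ) {x : EuclideanSpace ℝ (Fin 3)}
    (hx : x ≠ 0) (j k l : Fin 3) :
    ∑ m : Fin 3, Gammaalpha α x m j k * hmet α a b x m l =
      α / ‖x‖ ^ 2 * (kron j k - x j * x k / ‖x‖ ^ 2) * (a ‖x‖ * x l) := by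
  rw [← sum_coord_mul_hmet α a b hx l, Finset.mul_sum]
  refine Finset.sum_congr rfl fun m _ => ?_
  unfold Gammaalpha
  ring

/-- For α ∈ [0,1), differentiable a, b : (0,∞) → ℝ, and x ≠ 0, the covariant
derivative ∇^α_j h_{kl}(x) = ∂_j h_{kl}(x) − Σ_m Γ^m_{jk} h_{ml} − Σ_m Γ^m_{jl} h_{mk}
equals (1−α)b'(|x|)(x_j/|x|)δ_{kl} + (a'(|x|) − (1−α)b'(|x|)) x_j x_k x_l/|x|³
+ ((1−α)/|x|²)(a(|x|) − b(|x|))(δ_{jk}x_l + δ_{jl}x_k − 2x_j x_k x_l/|x|²). -/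
theorem covariant_derivative_spherical_metric (α : ℝ) (hα : α ∈ Set.Ico (0:ℝ) 1)
    (a b : ℝ → ℝ)
    (ha : ∀ r > (0:ℝ), DifferentiableAt ℝ a r)
    (hb : ∀ r > (0:ℝ), DifferentiableAt ℝ b r)
    (x : EuclideanSpace ℝ (Fin 3)) (hx : x ≠ 0) :
    ∀ j k l : Fin 3,
      pd j (fun y => hmet α a b y k l) x
        - (∑ m : Fin 3, Gammaalpha α x m j k * hmet α a b x m l)
        - (∑ m : Fin 3, Gammaalpha α x m j l * hmet α a b x m k)
      = (1 - α) * deriv b ‖x‖ * (x j / ‖x‖) * kron k l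
        + (deriv a ‖x‖ - (1 - α) * deriv b ‖x‖) * x j * x k * x l / ‖x‖^3
        + ((1 - α)/‖x‖^2) * (a ‖x‖ - b ‖x‖)
            * (kron j k * x l + kron j l * x k - 2 * x j * x k * x l / ‖x‖^2) := by
  intro j k l
  have hpos : 0 < ‖x‖ := norm_pos_iff.mpr hx
  rw [pd_hmet α hx (ha _ hpos) (hb _ hpos), sum_Gammaalpha_mul_hmet α a b hx,
    sum_Gammaalpha_mul_hmet α a b hx]
  ring

end
end

section
/- Fix K ∈ (0,1], n > 5 and ρ₀ > 0. Let m, ρ : (0,∞) → ℝ be a smooth solution of the polytropic system m'(r) = 4π r² ρ(r), ρ'(r) = −(n/(n+1)) · ((1 + K ρ(r)^{1/n}) ρ(r)^{(n−1)/n}/(r − 2m(r))) · (4π r² ρ(r)^{(n+1)/n} + m(r)/(rK)), with ρ(r) > 0 and r − 2m(r) > 0 for all r > 0, such that m(r) → 0 and ρ(r) → ρ₀ as r → 0⁺. Then as r → ∞: m(r) = ((2^{n−2} K^n/π) · (n−3)(n+1)^n/(n−1)^{n+1})^{1/(n−1)} · r^{(n−3)/(n−1)} + o(r^{(n−3)/(n−1)})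 and ρ(r) = ((K^n/(2^n π^n)) · (n+1)^n (n−3)^n/(n−1)^{2n})^{1/(n−1)} · r^{−2n/(n−1)} + o(r^{−2n/(n−1)}). -/
open Real Filter Asymptotics

/-- A Barbalat-type lemma. -/
theorem eventually_lt_of_tendsto_of_deriv_le {F F' φ φ' κ : ℝ → ℝ} {l : ℝ}
    (hF : ∀ t, HasDerivAt F (F' t) t) (hφ : ∀ t, HasDerivAt φ (φ' t) t)
    (hφ' : φ' =O[atTop] (fun _ => (1 : ℝ))) (hl : Tendsto F atTop (nhds l))
    (hle : ∀ᶠ t in atTop, F' t ≤ -φ t + κ t) (hκ : Tendsto κ atTop (nhds 0))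
    {η : ℝ} (hη : 0 < η) : ∀ᶠ t in atTop, φ t < η := by
  obtain ⟨L, hL, hLb⟩ := hφ'.exists_pos
  rw [IsBigOWith] at hLb
  set τ := η / (4 * L) with hτ
  have hτpos : 0 < τ := by positivity
  have hLτ : L * τ = η / 4 := by rw [hτ]; field_simp
  have hκ' : ∀ᶠ t in atTop, κ t < η / 4 := hκ.eventually_lt_const (by positivity)
  have hdiff : Tendsto (fun t => F (t + τ) - F t) atTop (nhds 0) := by
    simpa using (hl.comp (tendsto_atTop_add_const_right atTop τ tendsto_id)).sub hl
  have hdiff' : ∀ᶠ t in atTop, -(η / 2 * τ) < F (t + τ) - F t :=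
    hdiff.eventually_const_lt (by simpa using by positivity)
  obtain ⟨T, hT⟩ := eventually_atTop.1 (hLb.and (hκ'.and hle))
  filter_upwards [hdiff', eventually_ge_atTop T] with t ht htT
  by_contra! hcon
  obtain ⟨c, ⟨hc1, hc2⟩, hc⟩ := exists_hasDerivAt_eq_slope F F' (show t < t + τ by linarith)
    (fun x _ => (hF x).continuousAt.continuousWithinAt) (fun x _ => hF x)
  obtain ⟨d, ⟨hd1, hd2⟩, hd⟩ := exists_hasDerivAt_eq_slope φ φ' hc1
    (fun x _ => (hφ x).continuousAt.continuousWithinAt) (fun x _ => hφ x)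
  obtain ⟨-, hκc, hlec⟩ := hT c (by linarith)
  have hLd := (hT d (by linarith)).1
  simp only [norm_one, mul_one, Real.norm_eq_abs] at hLd
  have hLd' := (abs_le.1 hLd).1
  have hct : 0 < c - t := by linarith
  rw [eq_div_iff hct.ne'] at hd
  rw [add_sub_cancel_left, eq_div_iff hτpos.ne'] at hc
  have hφc : 3 * η / 4 ≤ φ c := by nlinarith
  nlinarith

theorem le_of_deriv_neg_of_eq {f f' : ℝ → ℝ} {t₀ c : ℝ} (hf : ∀ t, HasDerivAt f (f' t) t)
    (h₀ : f t₀ ≤ c) (hneg : ∀ t ≥ t₀, f t = c → f' t < 0) {t : ℝ} (ht : t₀ ≤ t) : f t ≤ c :=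
  image_le_of_deriv_right_lt_deriv_boundary (a := t₀) (b := t) (B := fun _ => c)
    (B' := fun _ => 0) (fun x _ => (hf x).continuousAt.continuousWithinAt)
    (fun x _ => (hf x).hasDerivWithinAt) h₀ (fun _ => hasDerivAt_const _ _)
    (fun x hx => hneg x hx.1) ⟨ht, le_rfl⟩

theorem antitoneOn_Ici_of_hasDerivAt_nonpos {f f' : ℝ → ℝ} {t₀ : ℝ}
    (hf : ∀ t, HasDerivAt f (f' t) t) (hneg : ∀ t ≥ t₀, f' t ≤ 0) :
    AntitoneOn f (Set.Ici t₀) :=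
  antitoneOn_of_hasDerivWithinAt_nonpos (convex_Ici t₀)
    (fun x _ => (hf x).continuousAt.continuousWithinAt)
    (fun x _ => (hf x).hasDerivWithinAt)
    (fun x hx => hneg x (interior_subset hx))

theorem exists_tendsto_of_antitoneOn_Ici {f : ℝ → ℝ} {t₀ B : ℝ} (hf : AntitoneOn f (Set.Ici t₀))
    (hB : ∀ t, B ≤ f t) : ∃ l, Tendsto f atTop (nhds l) := by
  have hanti : Antitone (fun t => f (max t₀ t)) := fun s t hst =>
    hf (Set.mem_Ici.2 (le_max_left _ _)) (Set.mem_Ici.2 (le_max_left _ _)) (max_le_max le_rfl hst)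
  refine ⟨_, (tendsto_atTop_ciInf hanti ⟨B, ?_⟩).congr' ?_⟩
  · rintro _ ⟨t, rfl⟩
    exact hB _
  · filter_upwards [eventually_ge_atTop t₀] with t ht
    rw [max_eq_right ht]

/-- Along a continuous curve `Y`, if `Y ^ p * (b - Y)` tends to zero, then `Y` tends either to `0`
or to `b`. -/
theorem tendsto_or_tendsto_of_rpow_mul_sub {Y : ℝ → ℝ} {p b : ℝ} (hY : Continuous Y)
    (hpos : ∀ t, 0 < Y t) (hp : 0 < p)
    (h : Tendsto (fun t => Y t ^ p * (b - Y t)) atTop (nhds 0)) :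
    Tendsto Y atTop (nhds 0) ∨ Tendsto Y atTop (nhds b) := by
  by_cases hlow : ∃ η > 0, ∀ᶠ t in atTop, η < Y t
  · right
    obtain ⟨η, hη, hev⟩ := hlow
    have hz : Tendsto (fun t => b - Y t) atTop (nhds 0) := by
      refine squeeze_zero_norm' (a := fun t => |Y t ^ p * (b - Y t)| / η ^ p) ?_ ?_
      · filter_upwards [hev] with t ht
        have h1 : 0 < η ^ p := rpow_pos_of_pos hη p
        have h2 : η ^ p ≤ Y t ^ p := rpow_le_rpow hη.le ht.le hp.le
        rw [le_div_iff₀ h1, abs_mul, abs_of_pos (h1.trans_le h2), mul_comm, Real.norm_eq_abs]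
        exact mul_le_mul_of_nonneg_right h2 (abs_nonneg _)
      · simpa using h.abs.div_const (η ^ p)
    simpa using (tendsto_const_nhds (x := b)).sub hz
  · left
    push Not at hlow
    have key : ∀ η > 0, η ≠ b → ∀ᶠ t in atTop, Y t < η := by
      intro η hη hηb
      have hne : 0 < |η ^ p * (b - η)| :=
        abs_pos.2 (mul_ne_zero (rpow_pos_of_pos hη p).ne' (sub_ne_zero.2 hηb.symm))
      have hev : ∀ᶠ t in atTop, |Y t ^ p * (b - Y t)| < |η ^ p * (b - η)| :=
        h.abs.eventually_lt_const (by rwa [abs_zero])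
      obtain ⟨T, hT⟩ := eventually_atTop.1 hev
      have hneq : ∀ t ≥ T, Y t ≠ η := fun t ht hYt => by
        have := hT t ht
        rw [hYt] at this
        exact lt_irrefl _ this
      obtain ⟨t₁, ht₁, hY₁⟩ := (frequently_atTop.1 (hlow η hη)) T
      filter_upwards [eventually_ge_atTop t₁] with t ht
      by_contra! hcon
      obtain ⟨s, hs, hs'⟩ := intermediate_value_Icc ht hY.continuousOn ⟨hY₁, hcon⟩
      exact hneq s (ht₁.trans hs.1) hs'
    refine tendsto_order.2 ⟨fun c hc => .of_forall fun t => hc.trans (hpos t), fun c hc => ?_⟩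
    by_cases hcb : c = b
    · filter_upwards [key (c / 2) (by positivity) (by rw [← hcb]; linarith)] with t ht
      linarith
    · exact key c hc hcb

/-- A bounded solution of the Lane–Emden equation of index `n > 5` in autonomous form, subject to
an exponentially small perturbation, has its logarithmic derivative `a - v` decay against `X` and
converges to one of the two equilibria. -/
theorem perturbed_laneEmden_tendsto {n a M B : ℝ} {X v κ : ℝ → ℝ} (hn : 1 < n)
    (ha : 0 < a) (ha2 : a < 1 / 2)
    (hXpos : ∀ t, 0 < X t) (hXM : ∀ t, X t ≤ M) (hvB : ∀ t, |v t| ≤ B)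
    (hX : ∀ t, HasDerivAt X ((a - v t) * X t) t)
    (hv : ∀ t, HasDerivAt v (v t ^ 2 - v t + X t ^ (n - 1) + κ t) t)
    (hκ : κ =O[atTop] (fun t => exp (-(a * t)))) :
    Tendsto (fun t => (a - v t) * X t) atTop (nhds 0) ∧
      (Tendsto (fun t => X t ^ (n - 1)) atTop (nhds 0) ∨
        Tendsto (fun t => X t ^ (n - 1)) atTop (nhds (a * (1 - a)))) := by
  have hn1 : 0 < n - 1 := by linarith
  obtain ⟨Y, hYX⟩ : ∃ Y : ℝ → ℝ, ∀ t, X t ^ (n - 1) = Y t := ⟨_, fun _ => rfl⟩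
  simp only [hYX] at hv ⊢
  have hYpos : ∀ t, 0 < Y t := fun t => hYX t ▸ rpow_pos_of_pos (hXpos t) _
  have hY : ∀ t, HasDerivAt Y ((n - 1) * (a - v t) * Y t) t := fun t => by
    rw [← funext hYX]
    refine ((hX t).rpow_const (p := n - 1) (Or.inl (hXpos t).ne')).congr_deriv ?_
    rw [rpow_sub_one (hXpos t).ne']
    have := (hXpos t).ne'
    field_simp
  have hexp : ∀ t, HasDerivAt (fun t => exp (-(a * t))) (exp (-(a * t)) * -a) t := fun t => by
    simpa using (((hasDerivAt_id t).const_mul a).neg).exp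
  have hexp0 : Tendsto (fun t => exp (-(a * t))) atTop (nhds 0) :=
    tendsto_exp_neg_atTop_nhds_zero.comp (tendsto_id.const_mul_atTop ha)
  have hκ0 : Tendsto κ atTop (nhds 0) := hκ.trans_tendsto hexp0
  have hκ1 : κ =O[atTop] (fun _ => (1 : ℝ)) := hκ0.isBigO_one ℝ
  have hX1 : X =O[atTop] (fun _ => (1 : ℝ)) := .of_bound M (.of_forall fun t => by
    simpa [abs_of_pos (hXpos t)] using hXM t)
  have hv1 : v =O[atTop] (fun _ => (1 : ℝ)) := .of_bound B (.of_forall fun t => by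
    simpa using hvB t)
  have hY1 : Y =O[atTop] (fun _ => (1 : ℝ)) := .of_bound (M ^ (n - 1)) (.of_forall fun t => by
    rw [← hYX, norm_one, mul_one, Real.norm_eq_abs, abs_of_pos (by rw [hYX]; exact hYpos t)]
    exact rpow_le_rpow (hXpos t).le (hXM t) hn1.le)
  have hc1 : ∀ c : ℝ, (fun _ : ℝ => c) =O[atTop] (fun _ : ℝ => (1 : ℝ)) := fun c =>
    isBigO_const_const c one_ne_zero _
  have hmul : ∀ {f g : ℝ → ℝ}, f =O[atTop] (fun _ => (1 : ℝ)) → g =O[atTop] (fun _ => (1 : ℝ)) →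
      (fun t => f t * g t) =O[atTop] (fun _ => (1 : ℝ)) := fun hf hg => by
    simpa only [mul_one] using hf.mul hg
  obtain ⟨g, hg⟩ : ∃ g : ℝ → ℝ, ∀ t, (a - v t) * X t = g t := ⟨_, fun _ => rfl⟩
  have hg' : ∀ t, HasDerivAt g
      (X t * (a * (1 - a) - Y t) - ((1 - 2 * a) * g t + X t * κ t)) t := fun t => by
    rw [← funext hg]
    refine (((hv t).const_sub a).mul (hX t)).congr_deriv ?_
    ring
  have hg1 : g =O[atTop] (fun _ => (1 : ℝ)) := by
    rw [← funext hg]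
    exact hmul ((hc1 a).sub hv1) hX1
  have hbY : (fun t => a * (1 - a) - Y t) =O[atTop] (fun _ => (1 : ℝ)) := (hc1 _).sub hY1
  have hg'1 : (fun t => X t * (a * (1 - a) - Y t) - ((1 - 2 * a) * g t + X t * κ t))
      =O[atTop] (fun _ => (1 : ℝ)) :=
    (hmul hX1 hbY).sub ((hmul (hc1 _) hg1).add (hmul hX1 hκ1))
  have hκXg : (fun t => κ t * (X t * g t)) =O[atTop] (fun t => exp (-(a * t))) := by
    simpa only [mul_one] using hκ.mul (hmul hX1 hg1)
  obtain ⟨C, hC, hCb⟩ := hκXg.exists_pos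
  rw [IsBigOWith] at hCb
  obtain ⟨T, hT⟩ := eventually_atTop.1 hCb
  obtain ⟨F, hF⟩ : ∃ F : ℝ → ℝ, ∀ t, g t ^ 2 / 2 - a * (1 - a) * X t ^ 2 / 2 +
      X t ^ 2 * Y t / (n + 1) + C / a * exp (-(a * t)) = F t := ⟨_, fun _ => rfl⟩
  have hF' : ∀ t, HasDerivAt F
      (-((1 - 2 * a) * g t ^ 2) - κ t * (X t * g t) - C * exp (-(a * t))) t := fun t => by
    rw [← funext hF]
    refine (((((hg' t).pow 2).div_const 2).sub
      ((((hX t).pow 2).const_mul (a * (1 - a))).div_const 2)).add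
      ((((hX t).pow 2).mul (hY t)).div_const (n + 1))).add
      ((hexp t).const_mul (C / a)) |>.congr_deriv ?_
    obtain ⟨v', hv'⟩ : ∃ v', v' = a - v t := ⟨_, rfl⟩
    simp only [Pi.pow_apply, ← hg, ← hv']
    field_simp
    ring
  have hFle : ∀ t ≥ T, -((1 - 2 * a) * g t ^ 2) - κ t * (X t * g t) - C * exp (-(a * t)) ≤
      -((1 - 2 * a) * g t ^ 2) := fun t ht => by
    have := hT t ht
    rw [Real.norm_eq_abs, Real.norm_eq_abs, abs_of_pos (exp_pos _)] at this
    linarith [(abs_le.1 this).1]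
  have hk : 0 < 1 - 2 * a := by linarith
  obtain ⟨l, hl⟩ : ∃ l, Tendsto F atTop (nhds l) := by
    refine exists_tendsto_of_antitoneOn_Ici (t₀ := T) (B := -(a * (1 - a) * M ^ 2 / 2))
      (antitoneOn_Ici_of_hasDerivAt_nonpos hF' fun t ht => (hFle t ht).trans ?_) fun t => ?_
    · have : 0 ≤ (1 - 2 * a) * g t ^ 2 := by positivity
      linarith
    · rw [← hF]
      have h1 : 0 ≤ g t ^ 2 / 2 := by positivity
      have h2 : 0 ≤ X t ^ 2 * Y t / (n + 1) :=
        div_nonneg (mul_nonneg (sq_nonneg _) (hYpos t).le) (by linarith)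
      have h3 : 0 ≤ C / a * exp (-(a * t)) := by positivity
      have h4 : a * (1 - a) * X t ^ 2 ≤ a * (1 - a) * M ^ 2 :=
        mul_le_mul_of_nonneg_left (pow_le_pow_left₀ (hXpos t).le (hXM t) 2)
          (mul_nonneg ha.le (by linarith))
      linarith
  have hg0 : Tendsto g atTop (nhds 0) := by
    rw [tendsto_zero_iff_abs_tendsto_zero]
    refine tendsto_order.2 ⟨fun c hc => .of_forall fun t => hc.trans_le (abs_nonneg _),
      fun c hc => ?_⟩
    have hφ : ∀ t, HasDerivAt (fun t => (1 - 2 * a) * g t ^ 2) ((1 - 2 * a) * (2 * (g t *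
        (X t * (a * (1 - a) - Y t) - ((1 - 2 * a) * g t + X t * κ t))))) t := fun t => by
      refine (((hg' t).pow 2).const_mul (1 - 2 * a)).congr_deriv ?_
      ring
    filter_upwards [eventually_lt_of_tendsto_of_deriv_le hF' hφ
      (hmul (hc1 _) (hmul (hc1 _) (hmul hg1 hg'1))) hl (κ := fun _ => 0)
      (eventually_atTop.2 ⟨T, fun t ht => by simpa using hFle t ht⟩) tendsto_const_nhds
      (show 0 < (1 - 2 * a) * c ^ 2 by positivity)] with t ht
    exact abs_lt_of_sq_lt_sq (lt_of_mul_lt_mul_left ht hk.le) hc.le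
  refine ⟨(funext hg : (fun t => (a - v t) * X t) = g) ▸ hg0, ?_⟩
  have hrem : Tendsto (fun t => (1 - 2 * a) * g t + X t * κ t) atTop (nhds 0) := by
    have h1 : Tendsto (fun t => X t * κ t) atTop (nhds 0) := by
      have := hX1.mul_isLittleO ((isLittleO_one_iff ℝ).2 hκ0)
      rw [mul_one] at this
      exact (isLittleO_one_iff ℝ).1 this
    simpa using (hg0.const_mul (1 - 2 * a)).add h1
  have hφ : ∀ t, HasDerivAt (fun t => X t * (a * (1 - a) - Y t))
      (g t * (a * (1 - a) - Y t) - g t * ((n - 1) * Y t)) t := fun t => by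
    refine ((hX t).mul ((hY t).const_sub (a * (1 - a)))).congr_deriv ?_
    rw [← hg]
    ring
  have hφ1 : (fun t => g t * (a * (1 - a) - Y t) - g t * ((n - 1) * Y t))
      =O[atTop] (fun _ => (1 : ℝ)) :=
    (hmul hg1 hbY).sub (hmul hg1 (hmul (hc1 _) hY1))
  have hφ0 : Tendsto (fun t => X t * (a * (1 - a) - Y t)) atTop (nhds 0) := by
    refine tendsto_order.2 ⟨fun c hc => ?_, fun c hc => ?_⟩
    · filter_upwards [eventually_lt_of_tendsto_of_deriv_le hg' (fun t => (hφ t).neg) hφ1.neg_left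
        hg0 (.of_forall fun t => by simp [sub_eq_add_neg])
        (κ := fun t => -((1 - 2 * a) * g t + X t * κ t)) (by simpa using hrem.neg)
        (neg_pos.2 hc)] with t ht
      exact neg_lt_neg_iff.1 ht
    · exact eventually_lt_of_tendsto_of_deriv_le (fun t => (hg' t).neg) hφ hφ1 hg0.neg
        (.of_forall fun t => by rw [neg_sub]; linarith) hrem hc
  have hXY : ∀ t, X t = Y t ^ (1 / (n - 1)) := fun t => by
    rw [← hYX, ← rpow_mul (hXpos t).le, mul_one_div_cancel hn1.ne', rpow_one]
  refine tendsto_or_tendsto_of_rpow_mul_sub (p := 1 / (n - 1))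
    (continuous_iff_continuousAt.2 fun t => (hY t).continuousAt) hYpos (by positivity) ?_
  simpa only [← hXY] using hφ0

/-- The equilibrium `X = 0` of the Lane–Emden system can be approached only along its stable
manifold, where `v` tends to `1`; a lower bound on a quantity with logarithmic derivative
`1 - 2 v` excludes this. -/
theorem not_tendsto_zero_of_lower_bound {a δ : ℝ} {X v κ S : ℝ → ℝ} (ha : 0 < a) (ha2 : a < 1 / 2)
    (hXpos : ∀ t, 0 < X t) (hX : ∀ t, HasDerivAt X ((a - v t) * X t) t)
    (hv : ∀ t, HasDerivAt v (v t ^ 2 - v t + κ t) t) (hκ : Tendsto κ atTop (nhds 0))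
    (hS : ∀ t, HasDerivAt S ((1 - 2 * v t) * S t) t) (hδ : 0 < δ)
    (hSδ : ∀ᶠ t in atTop, δ ≤ S t) : ¬ Tendsto X atTop (nhds 0) := by
  intro hX0
  obtain ⟨T, hT⟩ := eventually_atTop.1
    ((hκ.eventually_lt_const (show 0 < a / 16 by positivity)).and hSδ)
  have hv_neg : ∀ t ≥ T, a / 2 ≤ v t → v t ≤ 3 / 4 → v t ^ 2 - v t + κ t ≤ -(a / 16) := by
    intro t ht h1 h2
    nlinarith [(hT t ht).1]
  obtain ⟨t₁, ht₁, hv₁⟩ : ∃ t₁ ≥ T, v t₁ ≤ 3 / 4 := by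
    by_contra! hcon
    have hexp : ∀ t, HasDerivAt (fun t => exp (t / 2)) (exp (t / 2) * (1 / 2)) t := fun t =>
      ((hasDerivAt_id t).div_const 2).exp
    have hanti : AntitoneOn (fun t => S t * exp (t / 2)) (Set.Ici T) := by
      refine antitoneOn_Ici_of_hasDerivAt_nonpos (fun t => (hS t).mul (hexp t)) fun t ht => ?_
      have h1 : 0 < S t := hδ.trans_le (hT t ht).2
      have h2 := mul_pos h1 (exp_pos (t / 2))
      nlinarith [hcon t ht]
    have hlim : Tendsto (fun t => δ * exp (t / 2)) atTop atTop :=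
      (tendsto_exp_atTop.comp (tendsto_id.atTop_div_const two_pos)).const_mul_atTop hδ
    obtain ⟨t, ht, htT⟩ :=
      ((hlim.eventually_gt_atTop (S T * exp (T / 2))).and (eventually_ge_atTop T)).exists
    have h1 : S t * exp (t / 2) ≤ S T * exp (T / 2) := hanti Set.self_mem_Ici htT htT
    have h2 : δ * exp (t / 2) ≤ S t * exp (t / 2) :=
      mul_le_mul_of_nonneg_right (hT t htT).2 (exp_pos _).le
    linarith
  have hv₁' : ∀ t ≥ t₁, v t ≤ 3 / 4 := fun t ht =>
    le_of_deriv_neg_of_eq hv hv₁ (fun s hs hsv =>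
      (hv_neg s (ht₁.trans hs) (by linarith) hsv.le).trans_lt (by linarith)) ht
  obtain ⟨t₂, ht₂, hv₂⟩ : ∃ t₂ ≥ t₁, v t₂ ≤ a / 2 := by
    by_contra! hcon
    have hanti : AntitoneOn (fun t => v t + a / 16 * t) (Set.Ici t₁) := by
      refine antitoneOn_Ici_of_hasDerivAt_nonpos
        (fun t => (hv t).add ((hasDerivAt_id t).const_mul (a / 16))) fun t ht => ?_
      have := hv_neg t (ht₁.trans ht) (hcon t ht).le (hv₁' t ht)
      linarith
    have h1 : v (t₁ + 16 / a) + a / 16 * (t₁ + 16 / a) ≤ v t₁ + a / 16 * t₁ :=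
      hanti Set.self_mem_Ici (by simp; positivity) (by simp; positivity)
    have h2 : a / 16 * (t₁ + 16 / a) = a / 16 * t₁ + 1 := by field_simp
    have h3 := hcon (t₁ + 16 / a) (by simp; positivity)
    linarith
  have hv₂' : ∀ t ≥ t₂, v t ≤ a / 2 := fun t ht =>
    le_of_deriv_neg_of_eq hv hv₂ (fun s hs hsv =>
      (hv_neg s (ht₁.trans (ht₂.trans hs)) hsv.ge (by linarith)).trans_lt (by linarith)) ht
  have hmono : AntitoneOn (fun t => -X t) (Set.Ici t₂) := by
    refine antitoneOn_Ici_of_hasDerivAt_nonpos (fun t => (hX t).neg) fun t ht => ?_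
    have := hv₂' t ht
    exact neg_nonpos.2 (mul_nonneg (by linarith) (hXpos t).le)
  obtain ⟨t, ht, htt⟩ :=
    ((hX0.eventually_lt_const (hXpos t₂)).and (eventually_ge_atTop t₂)).exists
  exact ht.not_ge (neg_le_neg_iff.1 (hmono Set.self_mem_Ici htt htt))

/-- The logarithmic decay rate of `p / ρ` with respect to `log r`, in terms of `s = p / ρ`,
`m = m / r` and `d = 4 π r² ρ`. -/
noncomputable def decayRate (n s m d : ℝ) : ℝ :=
  (1 + s) * (m + s * d) / ((n + 1) * s * (1 - 2 * m))

/-- The polytropic system in the variables `σ = p / ρ`, `μ = m / r` and `D = 4 π r² ρ`, as functions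
of `t = log r`, for a solution that is regular at the centre and has no horizon. The equation of
state enters through the relation between `D` and `σ`. -/
structure IsPolytropicFlow (n k σ₀ : ℝ) (σ μ D : ℝ → ℝ) : Prop where
  five_lt : 5 < n
  k_pos : 0 < k
  σ_pos : ∀ t, 0 < σ t
  μ_pos : ∀ t, 0 < μ t
  two_mul_μ_lt : ∀ t, 2 * μ t < 1
  D_eq : ∀ t, D t = (n + 1) * σ t * (k * σ t * exp (2 / (n - 1) * t)) ^ (n - 1)
  D_le : ∀ t, D t ≤ 3 * μ t
  hasDerivAt_σ : ∀ t, HasDerivAt σ (-(σ t * decayRate n (σ t) (μ t) (D t))) t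
  hasDerivAt_μ : ∀ t, HasDerivAt μ (D t - μ t) t
  σ_le : ∀ t, σ t ≤ σ₀
  μ_tendsto : Tendsto μ atBot (nhds 0)

namespace IsPolytropicFlow

variable {n k σ₀ : ℝ} {σ μ D : ℝ → ℝ}

theorem D_pos (h : IsPolytropicFlow n k σ₀ σ μ D) (t : ℝ) : 0 < D t := by
  have h1 := h.five_lt
  have h2 := h.k_pos
  have h3 := h.σ_pos t
  rw [h.D_eq]
  positivity

theorem decayRate_pos (h : IsPolytropicFlow n k σ₀ σ μ D) (t : ℝ) :
    0 < decayRate n (σ t) (μ t) (D t) := by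
  have h1 := h.five_lt
  have h3 := h.σ_pos t
  have h4 := h.μ_pos t
  have h5 := h.D_pos t
  have h6 : 0 < 1 - 2 * μ t := by linarith [h.two_mul_μ_lt t]
  unfold decayRate
  positivity

theorem hasDerivAt_scaled (h : IsPolytropicFlow n k σ₀ σ μ D) (t : ℝ) :
    HasDerivAt (fun t => k * σ t * exp (2 / (n - 1) * t))
      ((2 / (n - 1) - decayRate n (σ t) (μ t) (D t)) * (k * σ t * exp (2 / (n - 1) * t))) t := by
  have h1 : HasDerivAt (fun t => exp (2 / (n - 1) * t))
      (exp (2 / (n - 1) * t) * (2 / (n - 1) * 1)) t :=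
    ((hasDerivAt_id t).const_mul _).exp
  exact (((h.hasDerivAt_σ t).const_mul k).mul h1).congr_deriv (by ring)

theorem scaled_pos (h : IsPolytropicFlow n k σ₀ σ μ D) (t : ℝ) :
    0 < k * σ t * exp (2 / (n - 1) * t) := by
  have h2 := h.k_pos
  have h3 := h.σ_pos t
  positivity

theorem hasDerivAt_scaled_rpow (h : IsPolytropicFlow n k σ₀ σ μ D) (t : ℝ) :
    HasDerivAt (fun t => (k * σ t * exp (2 / (n - 1) * t)) ^ (n - 1))
      ((2 - (n - 1) * decayRate n (σ t) (μ t) (D t)) *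
        (k * σ t * exp (2 / (n - 1) * t)) ^ (n - 1)) t := by
  have hn : n - 1 ≠ 0 := by linarith [h.five_lt]
  have hp := h.scaled_pos t
  convert (h.hasDerivAt_scaled t).rpow_const (p := n - 1) (Or.inl hp.ne') using 1
  rw [rpow_sub_one hp.ne' (n - 1)]
  generalize k * σ t * exp (2 / (n - 1) * t) = X at *
  field_simp

theorem hasDerivAt_D (h : IsPolytropicFlow n k σ₀ σ μ D) (t : ℝ) :
    HasDerivAt D (D t * (2 - n * decayRate n (σ t) (μ t) (D t))) t := by
  have h1 := ((h.hasDerivAt_σ t).const_mul (n + 1)).mul (h.hasDerivAt_scaled_rpow t)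
  have h2 : D = fun t => (n + 1) * σ t * (k * σ t * exp (2 / (n - 1) * t)) ^ (n - 1) :=
    funext h.D_eq
  rw [h2]
  refine h1.congr_deriv ?_
  rw [← h2, h.D_eq t]
  ring

/-- A potential of Pohozaev type: the Pohozaev functional of the conformal factor
`(1 + V) / 2`, where `V = (1 + σ) ^ (-(n + 1))` is the lapse. -/
noncomputable def pohozaev (n : ℝ) (σ μ D : ℝ → ℝ) (t : ℝ) : ℝ :=
  exp t * ((1 - ((1 + σ t) ^ (-(n + 1))) ^ 2) * (D t / 3 - μ t) +
    2 * ((1 + σ t) ^ (-(n + 1))) ^ 2 * (μ t + σ t * D t) ^ 2 / (1 - 2 * μ t))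

theorem lapse_mul_le (hn : 5 < n) {s : ℝ} (hs : 0 < s) :
    (1 + 6 * s) * (1 + s) ^ (-(n + 1)) ≤ 1 := by
  have h1 : 1 + (n + 1) * s ≤ (1 + s) ^ (n + 1) :=
    one_add_mul_self_le_rpow_one_add (by linarith) (by linarith)
  rw [rpow_neg (by linarith), ← div_eq_mul_inv, div_le_one (by positivity)]
  nlinarith

theorem one_sub_lapse_sq_le (hn : 5 < n) {s : ℝ} (hs : 0 < s) :
    1 - ((1 + s) ^ (-(n + 1))) ^ 2 ≤ 2 * (n + 1) * s / (1 + s) := by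
  have h1 : 1 + (n + 1) * (-(s / (1 + s))) ≤ (1 + -(s / (1 + s))) ^ (n + 1) := by
    refine one_add_mul_self_le_rpow_one_add ?_ (by linarith)
    rw [neg_le_neg_iff, div_le_one (by linarith)]
    linarith
  have h2 : 1 + -(s / (1 + s)) = (1 + s)⁻¹ := by field_simp; ring
  rw [h2, inv_rpow (by linarith), ← rpow_neg (by linarith)] at h1
  have h3 : (1 + s) ^ (-(n + 1)) ≤ 1 :=
    rpow_le_one_of_one_le_of_nonpos (by linarith) (by linarith)
  have h5 : 2 * (n + 1) * s / (1 + s) = 2 * ((n + 1) * (s / (1 + s))) := by ring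
  rw [h5]
  nlinarith

theorem hasDerivAt_lapse (h : IsPolytropicFlow n k σ₀ σ μ D) (t : ℝ) :
    HasDerivAt (fun t => (1 + σ t) ^ (-(n + 1))) ((1 + σ t) ^ (-(n + 1)) * (n + 1) * σ t *
      decayRate n (σ t) (μ t) (D t) / (1 + σ t)) t := by
  have hp : 0 < 1 + σ t := by linarith [h.σ_pos t]
  convert ((h.hasDerivAt_σ t).const_add 1).rpow_const (p := -(n + 1)) (Or.inl hp.ne') using 1
  rw [rpow_sub_one hp.ne']
  field_simp

theorem hasDerivAt_pohozaev (h : IsPolytropicFlow n k σ₀ σ μ D) (t : ℝ) :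
    HasDerivAt (pohozaev n σ μ D) (-(exp t / 3 * D t * decayRate n (σ t) (μ t) (D t) *
      (n * (1 + (1 + σ t) ^ (-(n + 1))) * (1 - (1 + 6 * σ t) * (1 + σ t) ^ (-(n + 1))) +
        (1 + (1 + σ t) ^ (-(n + 1))) * (1 + σ t) ^ (-(n + 1)) * σ t * (n - 5 + 6 * n * σ t) /
          (1 + σ t) +
        5 * (1 - (1 + 6 * σ t) * (1 + σ t) ^ (-(n + 1))) * (1 + σ t) ^ (-(n + 1)) * (n + 1) * σ t /
          (1 + σ t)))) t := by
  have hn := h.five_lt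
  have hs := h.σ_pos t
  have hm : 1 - 2 * μ t ≠ 0 := by linarith [h.two_mul_μ_lt t]
  have hV := (h.hasDerivAt_lapse t).pow 2
  have hN := (h.hasDerivAt_μ t).add ((h.hasDerivAt_σ t).mul (h.hasDerivAt_D t))
  have hden := ((h.hasDerivAt_μ t).const_mul 2).const_sub 1
  have hQ := (hasDerivAt_exp t).mul ((((hV.const_sub 1).mul
    (((h.hasDerivAt_D t).div_const 3).sub (h.hasDerivAt_μ t))).add
    (((hV.const_mul 2).mul (hN.pow 2)).div hden hm)))
  refine HasDerivAt.congr_deriv (f := pohozaev n σ μ D) hQ ?_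
  simp only [Pi.add_apply, Pi.mul_apply, Pi.pow_apply, Pi.sub_apply, Pi.div_apply, decayRate]
  generalize (1 + σ t) ^ (-(n + 1)) = V at *
  generalize exp t = e at *
  generalize σ t = s at *
  generalize μ t = u at *
  generalize D t = d at *
  obtain ⟨w, rfl⟩ : ∃ w, u = (1 - w) / 2 := ⟨1 - 2 * u, by ring⟩
  have hw : 1 - 2 * ((1 - w) / 2) = w := by ring
  rw [hw] at hm ⊢
  field_simp
  ring

theorem strictAnti_pohozaev (h : IsPolytropicFlow n k σ₀ σ μ D) :
    StrictAnti (pohozaev n σ μ D) := by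
  refine strictAnti_of_hasDerivAt_neg h.hasDerivAt_pohozaev fun t => neg_lt_zero.2 ?_
  have hn := h.five_lt
  have hs := h.σ_pos t
  have hD := h.D_pos t
  have hv := h.decayRate_pos t
  have h1 : 0 ≤ 1 - (1 + 6 * σ t) * (1 + σ t) ^ (-(n + 1)) :=
    sub_nonneg.2 (lapse_mul_le hn hs)
  positivity

theorem D_tendsto (h : IsPolytropicFlow n k σ₀ σ μ D) : Tendsto D atBot (nhds 0) :=
  squeeze_zero (fun t => (h.D_pos t).le) h.D_le (by simpa using h.μ_tendsto.const_mul 3)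

theorem pohozaev_tendsto (h : IsPolytropicFlow n k σ₀ σ μ D) :
    Tendsto (pohozaev n σ μ D) atBot (nhds 0) := by
  have hn := h.five_lt
  have hV : ∀ t, |((1 + σ t) ^ (-(n + 1))) ^ 2| ≤ 1 := fun t => by
    have hs := h.σ_pos t
    rw [abs_of_nonneg (by positivity)]
    exact pow_le_one₀ (by positivity)
      (rpow_le_one_of_one_le_of_nonpos (by linarith) (by linarith))
  have hVO : (fun t => ((1 + σ t) ^ (-(n + 1))) ^ 2) =O[atBot] (fun _ => (1 : ℝ)) :=
    .of_bound 1 (.of_forall fun t => by simpa using hV t)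
  have hσO : σ =O[atBot] (fun _ => (1 : ℝ)) :=
    .of_bound σ₀ (.of_forall fun t => by
      rw [norm_one, mul_one, Real.norm_eq_abs, abs_of_pos (h.σ_pos t)]
      exact h.σ_le t)
  have hμo : μ =o[atBot] (fun _ => (1 : ℝ)) := (isLittleO_one_iff ℝ).2 h.μ_tendsto
  have hDo : D =o[atBot] (fun _ => (1 : ℝ)) := (isLittleO_one_iff ℝ).2 h.D_tendsto
  have heo : exp =O[atBot] (fun _ => (1 : ℝ)) := tendsto_exp_atBot.isBigO_one ℝ
  have hden : (fun t => (1 - 2 * μ t)⁻¹) =O[atBot] (fun _ => (1 : ℝ)) := by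
    have : Tendsto (fun t => 1 - 2 * μ t) atBot (nhds 1) := by
      simpa using (h.μ_tendsto.const_mul 2).const_sub 1
    exact (this.inv₀ one_ne_zero).isBigO_one ℝ
  have hN : (fun t => μ t + σ t * D t) =o[atBot] (fun _ => (1 : ℝ)) := by
    simpa using hμo.add (by simpa using hσO.mul_isLittleO hDo)
  have hDμ : (fun t => D t / 3 - μ t) =o[atBot] (fun _ => (1 : ℝ)) := by
    simpa [div_eq_inv_mul] using (hDo.const_mul_left 3⁻¹).sub hμo
  have h1 : (fun t => (1 - ((1 + σ t) ^ (-(n + 1))) ^ 2) * (D t / 3 - μ t)) =o[atBot]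
      (fun _ => (1 : ℝ)) := by
    simpa using ((isBigO_refl (fun _ => (1 : ℝ)) _).sub hVO).mul_isLittleO hDμ
  have h2 : (fun t => 2 * ((1 + σ t) ^ (-(n + 1))) ^ 2 * (μ t + σ t * D t) ^ 2 / (1 - 2 * μ t))
      =o[atBot] (fun _ => (1 : ℝ)) := by
    simpa [div_eq_mul_inv] using
      ((hVO.const_mul_left 2).mul_isLittleO (hN.pow two_pos)).mul_isBigO hden
  rw [← isLittleO_one_iff ℝ]
  have h3 := heo.mul_isLittleO (h1.add h2)
  rw [mul_one] at h3
  exact h3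

theorem pohozaev_neg (h : IsPolytropicFlow n k σ₀ σ μ D) (t : ℝ) : pohozaev n σ μ D t < 0 :=
  (h.strictAnti_pohozaev (by linarith : t - 1 < t)).trans_le
    (h.strictAnti_pohozaev.antitone.ge_of_tendsto h.pohozaev_tendsto _)

theorem decayRate_le (h : IsPolytropicFlow n k σ₀ σ μ D) (t : ℝ) :
    decayRate n (σ t) (μ t) (D t) ≤ (1 + σ₀) ^ (2 * (n + 1)) := by
  have hn := h.five_lt
  have hs := h.σ_pos t
  have hm := h.μ_pos t
  have hD := h.D_pos t
  have hden : 0 < 1 - 2 * μ t := by linarith [h.two_mul_μ_lt t]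
  have hV : 0 < (1 + σ t) ^ (-(n + 1)) := rpow_pos_of_pos (by linarith) _
  have h1 := one_sub_lapse_sq_le hn hs
  have h2 : ((1 + σ t) ^ (-(n + 1))) ^ 2 = ((1 + σ t) ^ (2 * (n + 1)))⁻¹ := by
    rw [← rpow_natCast, ← rpow_mul (by linarith), ← rpow_neg (by linarith)]
    congr 1
    push_cast
    ring
  have h0 := neg_of_mul_neg_right (h.pohozaev_neg t) (exp_pos t).le
  have hN : 0 < μ t + σ t * D t := by positivity
  have h3 : ((1 + σ t) ^ (-(n + 1))) ^ 2 * decayRate n (σ t) (μ t) (D t) ≤ 1 := by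
    have hV1 : ((1 + σ t) ^ (-(n + 1))) ^ 2 ≤ 1 := pow_le_one₀ hV.le
      (rpow_le_one_of_one_le_of_nonpos (by linarith) (by linarith))
    have h4 : 2 * ((1 + σ t) ^ (-(n + 1))) ^ 2 * (μ t + σ t * D t) ^ 2 / (1 - 2 * μ t) ≤
        2 * (n + 1) * σ t / (1 + σ t) * (μ t + σ t * D t) := by
      have h5 : (1 - ((1 + σ t) ^ (-(n + 1))) ^ 2) * μ t ≤
          2 * (n + 1) * σ t / (1 + σ t) * (μ t + σ t * D t) := by
        apply mul_le_mul h1 (by nlinarith) hm.le (by positivity)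
      have h6 : 0 ≤ (1 - ((1 + σ t) ^ (-(n + 1))) ^ 2) * (D t / 3) :=
        mul_nonneg (by linarith) (by positivity)
      linarith
    generalize ((1 + σ t) ^ (-(n + 1))) ^ 2 = W at *
    rw [div_mul_eq_mul_div, div_le_div_iff₀ hden (by positivity)] at h4
    rw [decayRate, mul_div_assoc', div_le_one (by positivity)]
    refine le_of_mul_le_mul_right ?_ (mul_pos two_pos hN)
    linarith
  rw [h2, inv_mul_le_one₀ (by positivity)] at h3
  exact h3.trans (rpow_le_rpow (by linarith) (by linarith [h.σ_le t]) (by linarith))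

/-- The deviation of the flow from the Newtonian (Lane–Emden) one. -/
noncomputable def laneEmdenError (n k : ℝ) (σ μ D : ℝ → ℝ) (t : ℝ) : ℝ :=
  (k * σ t * exp (2 / (n - 1) * t)) ^ (n - 1) *
      ((σ t + σ t * (D t / μ t) + σ t * (σ t * (D t / μ t)) + 2 * μ t) * (1 - 2 * μ t)⁻¹) +
    decayRate n (σ t) (μ t) (D t) *
      (2 * (D t - μ t) * (1 - 2 * μ t)⁻¹ - σ t * (decayRate n (σ t) (μ t) (D t) * (1 + σ t)⁻¹) +
        σ t * (D t / (μ t + σ t * D t) *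
          (3 - D t / μ t - (n + 1) * decayRate n (σ t) (μ t) (D t))))

theorem hasDerivAt_decayRate (h : IsPolytropicFlow n k σ₀ σ μ D) (t : ℝ) :
    HasDerivAt (fun t => decayRate n (σ t) (μ t) (D t))
      (decayRate n (σ t) (μ t) (D t) ^ 2 - decayRate n (σ t) (μ t) (D t) +
        (k * σ t * exp (2 / (n - 1) * t)) ^ (n - 1) + laneEmdenError n k σ μ D t) t := by
  have hn := h.five_lt
  have hs := h.σ_pos t
  have hm := h.μ_pos t
  have hD := h.D_pos t
  have hw : 0 < 1 - 2 * μ t := by linarith [h.two_mul_μ_lt t]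
  have hn1 : 0 < n + 1 := by linarith
  have hN := (h.hasDerivAt_μ t).add ((h.hasDerivAt_σ t).mul (h.hasDerivAt_D t))
  have hden := ((h.hasDerivAt_μ t).const_mul 2).const_sub 1
  have hv := (((h.hasDerivAt_σ t).const_add 1).mul hN).div
    (((h.hasDerivAt_σ t).const_mul (n + 1)).mul hden) (by simpa using ⟨⟨hn1.ne', hs.ne'⟩, hw.ne'⟩)
  refine HasDerivAt.congr_deriv hv ?_
  have hY : (k * σ t * exp (2 / (n - 1) * t)) ^ (n - 1) = D t / ((n + 1) * σ t) := by
    rw [h.D_eq t]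
    field_simp
  simp only [laneEmdenError, hY, Pi.add_apply, Pi.mul_apply, decayRate]
  have hNpos : 0 < μ t + σ t * D t := by positivity
  clear hY hv hden hN
  generalize σ t = s at *
  generalize μ t = u at *
  generalize D t = d at *
  obtain ⟨N, rfl⟩ : ∃ N, d = (N - u) / s := ⟨u + s * d, by field_simp; ring⟩
  have hN : u + s * ((N - u) / s) = N := by field_simp; ring
  rw [hN] at hNpos ⊢
  obtain ⟨w, rfl⟩ : ∃ w, u = (1 - w) / 2 := ⟨1 - 2 * u, by ring⟩
  have hw' : 1 - 2 * ((1 - w) / 2) = w := by ring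
  rw [hw'] at hw ⊢
  field_simp
  ring

theorem μ_le (h : IsPolytropicFlow n k σ₀ σ μ D) (t : ℝ) :
    μ t ≤ (n + 1) * σ t * decayRate n (σ t) (μ t) (D t) := by
  have hn := h.five_lt
  have hs := h.σ_pos t
  have hm := h.μ_pos t
  have hD := h.D_pos t
  have hw : 0 < 1 - 2 * μ t := by linarith [h.two_mul_μ_lt t]
  have key : (n + 1) * σ t * decayRate n (σ t) (μ t) (D t) =
      (1 + σ t) * (μ t + σ t * D t) / (1 - 2 * μ t) := by
    unfold decayRate
    field_simp
  rw [key, le_div_iff₀ hw]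
  have : 0 < σ t * D t := by positivity
  nlinarith

theorem scaled_rpow_le (h : IsPolytropicFlow n k σ₀ σ μ D) (t : ℝ) :
    (k * σ t * exp (2 / (n - 1) * t)) ^ (n - 1) ≤ 3 * (1 + σ₀) ^ (2 * (n + 1)) := by
  have hn := h.five_lt
  have hs := h.σ_pos t
  refine le_trans ?_ (mul_le_mul_of_nonneg_left (h.decayRate_le t) zero_le_three)
  have h1 := h.D_le t
  rw [h.D_eq t] at h1
  have h2 := h.μ_le t
  refine le_of_mul_le_mul_left ?_ (show 0 < (n + 1) * σ t by positivity)
  linarith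

theorem scaled_le (h : IsPolytropicFlow n k σ₀ σ μ D) (t : ℝ) :
    k * σ t * exp (2 / (n - 1) * t) ≤ 1 + 3 * (1 + σ₀) ^ (2 * (n + 1)) := by
  have h1 := h.scaled_rpow_le t
  have h2 := h.scaled_pos t
  rcases le_total (k * σ t * exp (2 / (n - 1) * t)) 1 with h3 | h3
  · linarith [rpow_nonneg h2.le (n - 1)]
  · have := self_le_rpow_of_one_le h3 (show 1 ≤ n - 1 by linarith [h.five_lt])
    linarith

theorem decayRate_isBigO (h : IsPolytropicFlow n k σ₀ σ μ D) :
    (fun t => decayRate n (σ t) (μ t) (D t)) =O[atTop] (fun _ => (1 : ℝ)) :=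
  .of_bound _ (.of_forall fun t => by
    rw [norm_one, mul_one, Real.norm_eq_abs, abs_of_pos (h.decayRate_pos t)]
    exact h.decayRate_le t)

theorem scaled_isBigO (h : IsPolytropicFlow n k σ₀ σ μ D) :
    (fun t => k * σ t * exp (2 / (n - 1) * t)) =O[atTop] (fun _ => (1 : ℝ)) :=
  .of_bound _ (.of_forall fun t => by
    rw [norm_one, mul_one, Real.norm_eq_abs, abs_of_pos (h.scaled_pos t)]
    exact h.scaled_le t)

theorem σ_isBigO (h : IsPolytropicFlow n k σ₀ σ μ D) :
    σ =O[atTop] (fun t => exp (-(2 / (n - 1) * t))) := by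
  have hk := h.k_pos.ne'
  refine ((h.scaled_isBigO.const_mul_left k⁻¹).mul
    (isBigO_refl (fun t => exp (-(2 / (n - 1) * t))) atTop)).congr (fun t => ?_) fun t => one_mul _
  rw [exp_neg]
  field_simp

theorem μ_isBigO (h : IsPolytropicFlow n k σ₀ σ μ D) :
    μ =O[atTop] (fun t => exp (-(2 / (n - 1) * t))) := by
  refine IsBigO.trans (.of_bound 1 (.of_forall fun t => ?_))
    (((h.σ_isBigO.const_mul_left (n + 1)).mul h.decayRate_isBigO).trans
      (.of_bound 1 (.of_forall fun t => by simp)))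
  rw [one_mul, Real.norm_eq_abs, Real.norm_eq_abs, abs_of_pos (h.μ_pos t)]
  exact (h.μ_le t).trans (le_abs_self _)

theorem exp_neg_tendsto (h : IsPolytropicFlow n k σ₀ σ μ D) :
    Tendsto (fun t => exp (-(2 / (n - 1) * t))) atTop (nhds 0) :=
  tendsto_exp_neg_atTop_nhds_zero.comp
    (tendsto_id.const_mul_atTop (div_pos two_pos (by linarith [h.five_lt])))

theorem laneEmdenError_isBigO (h : IsPolytropicFlow n k σ₀ σ μ D) :
    laneEmdenError n k σ μ D =O[atTop] (fun t => exp (-(2 / (n - 1) * t))) := by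
  have hmul : ∀ {f g e : ℝ → ℝ}, f =O[atTop] (fun _ => (1 : ℝ)) → g =O[atTop] e →
      (fun t => f t * g t) =O[atTop] e := fun hf hg => by
    simpa only [one_mul] using hf.mul hg
  have hmul' : ∀ {f g e : ℝ → ℝ}, f =O[atTop] e → g =O[atTop] (fun _ => (1 : ℝ)) →
      (fun t => f t * g t) =O[atTop] e := fun hf hg => by
    simpa only [mul_one] using hf.mul hg
  have hc1 : ∀ c : ℝ, (fun _ : ℝ => c) =O[atTop] (fun _ : ℝ => (1 : ℝ)) := fun c =>
    isBigO_const_const c one_ne_zero _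
  have hσ := h.σ_isBigO
  have hμ := h.μ_isBigO
  have hv := h.decayRate_isBigO
  have hD : D =O[atTop] (fun t => exp (-(2 / (n - 1) * t))) :=
    IsBigO.trans (.of_bound 3 (.of_forall fun t => by
      rw [Real.norm_eq_abs, Real.norm_eq_abs, abs_of_pos (h.D_pos t), abs_of_pos (h.μ_pos t)]
      exact h.D_le t)) hμ
  have hσ1 : σ =O[atTop] (fun _ => (1 : ℝ)) :=
    (hσ.trans_tendsto h.exp_neg_tendsto).isBigO_one ℝ
  have hU : (fun t => D t / μ t) =O[atTop] (fun _ => (1 : ℝ)) :=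
    .of_bound 3 (.of_forall fun t => by
      rw [norm_one, mul_one, Real.norm_eq_abs, abs_of_pos (div_pos (h.D_pos t) (h.μ_pos t)),
        div_le_iff₀ (h.μ_pos t)]
      exact h.D_le t)
  have hDN : (fun t => D t / (μ t + σ t * D t)) =O[atTop] (fun _ => (1 : ℝ)) :=
    .of_bound 3 (.of_forall fun t => by
      have h1 := mul_pos (h.σ_pos t) (h.D_pos t)
      have h2 := add_pos (h.μ_pos t) h1
      rw [norm_one, mul_one, Real.norm_eq_abs, abs_of_pos (div_pos (h.D_pos t) h2),
        div_le_iff₀ h2]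
      linarith [h.D_le t])
  have hs : (fun t => (1 + σ t)⁻¹) =O[atTop] (fun _ => (1 : ℝ)) :=
    .of_bound 1 (.of_forall fun t => by
      have h1 := h.σ_pos t
      rw [norm_one, mul_one, Real.norm_eq_abs, abs_of_pos (by positivity)]
      exact inv_le_one_of_one_le₀ (by linarith))
  have hw : (fun t => (1 - 2 * μ t)⁻¹) =O[atTop] (fun _ => (1 : ℝ)) := by
    have : Tendsto (fun t => 1 - 2 * μ t) atTop (nhds 1) := by
      simpa using ((hμ.trans_tendsto h.exp_neg_tendsto).const_mul 2).const_sub 1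
    exact (this.inv₀ one_ne_zero).isBigO_one ℝ
  have hY : (fun t => (k * σ t * exp (2 / (n - 1) * t)) ^ (n - 1)) =O[atTop]
      (fun _ => (1 : ℝ)) :=
    .of_bound _ (.of_forall fun t => by
      rw [norm_one, mul_one, Real.norm_eq_abs, abs_of_pos (rpow_pos_of_pos (h.scaled_pos t) _)]
      exact h.scaled_rpow_le t)
  exact (hmul hY (hmul' (((hσ.add (hmul' hσ hU)).add (hmul' hσ (hmul hσ1 hU))).add
    (hμ.const_mul_left 2)) hw)).add (hmul hv ((((hmul' ((hD.sub hμ).const_mul_left 2) hw).sub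
    (hmul' hσ (hmul hv hs)))).add
    (hmul' hσ (hmul hDN (((hc1 3).sub hU).sub (hmul (hc1 (n + 1)) hv))))))

theorem exists_pos_le_exp_mul_sq (h : IsPolytropicFlow n k σ₀ σ μ D) :
    ∃ δ > 0, ∀ᶠ t in atTop, δ ≤ exp t * σ t ^ 2 := by
  have hn := h.five_lt
  have hσ₀ : 0 < σ₀ := (h.σ_pos 0).trans_le (h.σ_le 0)
  have hC : 0 < 2 * (n + 1) ^ 2 * (1 + σ₀) ^ (2 * (n + 1)) := by positivity
  refine ⟨-pohozaev n σ μ D 0 / (2 * (n + 1) ^ 2 * (1 + σ₀) ^ (2 * (n + 1))),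
    div_pos (neg_pos.2 (h.pohozaev_neg 0)) hC, ?_⟩
  filter_upwards [eventually_ge_atTop 0] with t ht
  rw [div_le_iff₀ hC]
  refine (neg_le_neg (h.strictAnti_pohozaev.antitone ht)).trans ?_
  have hs := h.σ_pos t
  have hm := h.μ_pos t
  have hD := h.D_pos t
  have hw : 0 < 1 - 2 * μ t := by linarith [h.two_mul_μ_lt t]
  have h1 := one_sub_lapse_sq_le hn hs
  have h2 : ((1 + σ t) ^ (-(n + 1))) ^ 2 ≤ 1 := pow_le_one₀ (by positivity)
    (rpow_le_one_of_one_le_of_nonpos (by linarith) (by linarith))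
  have h3 : 0 ≤ 2 * ((1 + σ t) ^ (-(n + 1))) ^ 2 * (μ t + σ t * D t) ^ 2 / (1 - 2 * μ t) := by
    positivity
  have h4 : 0 ≤ (1 - ((1 + σ t) ^ (-(n + 1))) ^ 2) * (D t / 3) :=
    mul_nonneg (by linarith) (by positivity)
  have h5 : 2 * (n + 1) * σ t / (1 + σ t) ≤ 2 * (n + 1) * σ t :=
    div_le_self (by positivity) (by linarith)
  have h6 : (1 - ((1 + σ t) ^ (-(n + 1))) ^ 2) * μ t ≤
      2 * (n + 1) * σ t * ((n + 1) * σ t * (1 + σ₀) ^ (2 * (n + 1))) :=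
    mul_le_mul (h1.trans h5) ((h.μ_le t).trans
      (mul_le_mul_of_nonneg_left (h.decayRate_le t) (by positivity))) hm.le (by positivity)
  have h7 : -pohozaev n σ μ D t ≤
      exp t * (2 * (n + 1) * σ t * ((n + 1) * σ t * (1 + σ₀) ^ (2 * (n + 1)))) := by
    rw [pohozaev, ← mul_neg]
    exact mul_le_mul_of_nonneg_left (by linarith) (exp_pos t).le
  refine h7.trans_eq ?_
  ring

theorem scaled_rpow_and_decayRate_tendsto (h : IsPolytropicFlow n k σ₀ σ μ D) :
    Tendsto (fun t => k * σ t * exp (2 / (n - 1) * t)) atTop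
      (nhds ((2 / (n - 1) * (1 - 2 / (n - 1))) ^ (1 / (n - 1)))) ∧
    Tendsto (fun t => decayRate n (σ t) (μ t) (D t)) atTop (nhds (2 / (n - 1))) := by
  have hn := h.five_lt
  have hn1 : 0 < n - 1 := by linarith
  have ha : 0 < 2 / (n - 1) := by positivity
  have ha2 : 2 / (n - 1) < 1 / 2 := by rw [div_lt_div_iff₀ hn1 two_pos]; linarith
  have hb : 0 < 2 / (n - 1) * (1 - 2 / (n - 1)) := mul_pos ha (by linarith)
  have hXY : ∀ {c : ℝ}, Tendsto (fun t => (k * σ t * exp (2 / (n - 1) * t)) ^ (n - 1)) atTop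
      (nhds c) → Tendsto (fun t => k * σ t * exp (2 / (n - 1) * t)) atTop
      (nhds (c ^ (1 / (n - 1)))) := fun hc => by
    refine (hc.rpow_const (p := 1 / (n - 1)) (Or.inr (by positivity))).congr fun t => ?_
    rw [← rpow_mul (h.scaled_pos t).le, mul_one_div_cancel hn1.ne', rpow_one]
  obtain ⟨hg, h0 | hb0⟩ := perturbed_laneEmden_tendsto (by linarith) ha ha2 h.scaled_pos h.scaled_le
    (fun t => (abs_of_pos (h.decayRate_pos t)).trans_le (h.decayRate_le t)) h.hasDerivAt_scaled
    h.hasDerivAt_decayRate h.laneEmdenError_isBigO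
  · exfalso
    obtain ⟨δ, hδ, hδS⟩ := h.exists_pos_le_exp_mul_sq
    refine not_tendsto_zero_of_lower_bound ha ha2 h.scaled_pos h.hasDerivAt_scaled
      (fun t => (h.hasDerivAt_decayRate t).congr_deriv (add_assoc _ _ _))
      (by simpa using h0.add (h.laneEmdenError_isBigO.trans_tendsto h.exp_neg_tendsto))
      (S := fun t => exp t * σ t ^ 2) (fun t => ?_) hδ hδS ?_
    · refine ((hasDerivAt_exp t).mul ((h.hasDerivAt_σ t).pow 2)).congr_deriv ?_
      simp only [Pi.pow_apply]
      ring
    · simpa [zero_rpow (inv_pos.2 hn1).ne'] using hXY h0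
  · have hX := hXY hb0
    refine ⟨hX, ?_⟩
    have h1 := (hg.div hX (rpow_pos_of_pos hb _).ne').const_sub (2 / (n - 1))
    rw [zero_div, sub_zero] at h1
    refine h1.congr fun t => ?_
    rw [Pi.div_apply, mul_div_cancel_right₀ _ (h.scaled_pos t).ne', sub_sub_cancel]

theorem μ_div_σ_tendsto (h : IsPolytropicFlow n k σ₀ σ μ D) :
    Tendsto (fun t => μ t / σ t) atTop (nhds ((n + 1) * (2 / (n - 1)))) := by
  have hn := h.five_lt
  have hσ := h.σ_isBigO.trans_tendsto h.exp_neg_tendsto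
  have hμ := h.μ_isBigO.trans_tendsto h.exp_neg_tendsto
  have hD : Tendsto D atTop (nhds 0) :=
    squeeze_zero (fun t => (h.D_pos t).le) h.D_le (by simpa using hμ.const_mul 3)
  have h1 := (((h.scaled_rpow_and_decayRate_tendsto.2.const_mul (n + 1)).mul
    ((hμ.const_mul 2).const_sub 1)).div (hσ.const_add 1) (by norm_num)).sub hD
  simp only [mul_zero, sub_zero, mul_one, add_zero, div_one] at h1
  refine h1.congr fun t => ?_
  have hs := h.σ_pos t
  have hw : 1 - 2 * μ t ≠ 0 := by linarith [h.two_mul_μ_lt t]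
  simp only [Pi.div_apply, decayRate]
  generalize μ t = u at *
  obtain ⟨w, rfl⟩ : ∃ w, u = (1 - w) / 2 := ⟨1 - 2 * u, by ring⟩
  have hw' : 1 - 2 * ((1 - w) / 2) = w := by ring
  rw [hw'] at hw ⊢
  field_simp
  ring

end IsPolytropicFlow

theorem isLittleO_sub_rpow_of_tendsto {f : ℝ → ℝ} {p c : ℝ}
    (h : Tendsto (fun t => f (exp t) * exp (-(p * t))) atTop (nhds c)) :
    (fun r => f r - c * r ^ p) =o[atTop] (fun r => r ^ p) := by
  have h1 := (h.comp tendsto_log_atTop).sub_const c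
  rw [sub_self] at h1
  refine (isLittleO_iff_tendsto' ?_).2 (h1.congr' ?_)
  · filter_upwards [eventually_gt_atTop 0] with r hr h0
    exact absurd h0 (rpow_pos_of_pos hr p).ne'
  · filter_upwards [eventually_gt_atTop 0] with r hr
    have h2 : exp (-(p * log r)) = (r ^ p)⁻¹ := by
      rw [exp_neg, rpow_def_of_pos hr, mul_comm]
    simp only [Function.comp_apply, exp_log hr, h2]
    field_simp

theorem lt_of_tendsto_zero_of_hasDerivAt_pos {f f' : ℝ → ℝ} {l : ℝ}
    (hf : ∀ r > 0, HasDerivAt f (f' r) r) (hf' : ∀ r > 0, 0 < f' r)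
    (hl : Tendsto f (nhdsWithin 0 (Set.Ioi 0)) (nhds l)) {r : ℝ} (hr : 0 < r) : l < f r := by
  have hmono : StrictMonoOn f (Set.Ioi 0) := by
    refine strictMonoOn_of_deriv_pos (convex_Ioi 0)
      (fun x hx => (hf x hx).continuousAt.continuousWithinAt) fun x hx => ?_
    rw [interior_Ioi] at hx
    rw [(hf x hx).deriv]
    exact hf' x hx
  have hr2 : 0 < r / 2 := half_pos hr
  refine lt_of_le_of_lt (le_of_tendsto hl ?_) (hmono hr2 hr (half_lt_self hr))
  filter_upwards [Ioo_mem_nhdsGT hr2] with x hx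
  exact (hmono hx.1 hr2 hx.2).le

section Polytrope

variable {K n ρ₀ : ℝ} {m ρ : ℝ → ℝ}

theorem hasDerivAt_density (hK : 0 < K) (hn : 0 < n) {r : ℝ} (hr : 0 < r) (hρpos : 0 < ρ r)
    (hhor : 0 < r - 2 * m r)
    (hρ : HasDerivAt ρ
      (-(n/(n+1)) * ((1 + K * ρ r ^ ((1:ℝ)/n)) * ρ r ^ ((n-1)/n) / (r - 2 * m r))
        * (4 * π * r^2 * ρ r ^ ((n+1)/n) + m r / (r * K))) r) :
    HasDerivAt ρ
      (-(n * ρ r * decayRate n (K * ρ r ^ (1 / n)) (m r / r) (4 * π * r ^ 2 * ρ r) / r)) r := by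
  refine hρ.congr_deriv ?_
  have h1 : ρ r ^ ((n - 1) / n) = ρ r / ρ r ^ (1 / n) := by
    rw [sub_div, div_self hn.ne', rpow_sub hρpos, rpow_one]
  have h2 : ρ r ^ ((n + 1) / n) = ρ r * ρ r ^ (1 / n) := by
    rw [add_div, div_self hn.ne', rpow_add hρpos, rpow_one]
  have h3 : 1 - 2 * (m r / r) = (r - 2 * m r) / r := by field_simp
  rw [h1, h2, decayRate, h3]
  generalize ρ r ^ (1 / n) = θ at *
  generalize r - 2 * m r = w at *
  field_simp
  ring

theorem isPolytropicFlow (hK : 0 < K) (hn : 5 < n)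
    (hρpos : ∀ r > 0, 0 < ρ r) (hhor : ∀ r > 0, 0 < r - 2 * m r)
    (hm : ∀ r > 0, HasDerivAt m (4 * π * r ^ 2 * ρ r) r)
    (hρ : ∀ r > 0, HasDerivAt ρ
      (-(n * ρ r * decayRate n (K * ρ r ^ (1 / n)) (m r / r) (4 * π * r ^ 2 * ρ r) / r)) r)
    (hm0 : Tendsto m (nhdsWithin 0 (Set.Ioi 0)) (nhds 0))
    (hρ0 : Tendsto ρ (nhdsWithin 0 (Set.Ioi 0)) (nhds ρ₀)) :
    IsPolytropicFlow n ((4 * π / ((n + 1) * K ^ n)) ^ (1 / (n - 1))) (K * ρ₀ ^ (1 / n))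
      (fun t => K * ρ (exp t) ^ (1 / n)) (fun t => m (exp t) / exp t)
      (fun t => 4 * π * exp t ^ 2 * ρ (exp t)) := by
  have hid : Tendsto (fun r : ℝ => r) (nhdsWithin 0 (Set.Ioi 0)) (nhds 0) :=
    tendsto_id.mono_left nhdsWithin_le_nhds
  have hmpos : ∀ r > 0, 0 < m r := fun r hr =>
    lt_of_tendsto_zero_of_hasDerivAt_pos hm
      (fun r hr => mul_pos (by positivity) (hρpos r hr)) hm0 hr
  have hv : ∀ r > 0,
      0 < n * ρ r * decayRate n (K * ρ r ^ (1 / n)) (m r / r) (4 * π * r ^ 2 * ρ r) / r := by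
    intro r hr
    have h1 := hρpos r hr
    have h2 := hmpos r hr
    have h3 : 0 < 1 - 2 * (m r / r) := by
      have := div_pos (hhor r hr) hr
      rwa [sub_div, div_self hr.ne', mul_div_assoc] at this
    unfold decayRate
    positivity
  have hρlt : ∀ r > 0, ρ r < ρ₀ := fun r hr =>
    neg_lt_neg_iff.1 (lt_of_tendsto_zero_of_hasDerivAt_pos (fun r hr => (hρ r hr).neg)
      (fun r hr => by simpa using hv r hr) hρ0.neg hr)
  have hpow : ∀ r, HasDerivAt (fun r : ℝ => r ^ 3) (3 * r ^ 2) r := fun r => by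
    simpa using hasDerivAt_pow 3 r
  have hDle : ∀ r > 0, 4 * π / 3 * (r ^ 3 * ρ r) < m r := fun r hr => by
    refine sub_pos.1 (lt_of_tendsto_zero_of_hasDerivAt_pos (l := 0)
      (f := fun r => m r - 4 * π / 3 * (r ^ 3 * ρ r)) (fun r hr =>
        ((hm r hr).sub (((hpow r).mul (hρ r hr)).const_mul (4 * π / 3)))) (fun r hr => ?_) ?_ hr)
    · have h1 := mul_pos (show 0 < 4 * π / 3 * r ^ 3 by positivity) (hv r hr)
      linarith
    · simpa using hm0.sub (((hid.pow 3).mul hρ0).const_mul (4 * π / 3))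
  have hmle : ∀ r > 0, m r < 4 * π / 3 * ρ₀ * r ^ 3 := fun r hr => by
    refine sub_pos.1 (lt_of_tendsto_zero_of_hasDerivAt_pos (l := 0)
      (f := fun r => 4 * π / 3 * ρ₀ * r ^ 3 - m r) (fun r hr =>
        (((hpow r).const_mul (4 * π / 3 * ρ₀)).sub (hm r hr))) (fun r hr => ?_) ?_ hr)
    · have h1 := mul_pos (show 0 < 4 * π * r ^ 2 by positivity) (sub_pos.2 (hρlt r hr))
      linarith
    · simpa using ((hid.pow 3).const_mul (4 * π / 3 * ρ₀)).sub hm0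
  have hn0 : n ≠ 0 := by linarith
  have hn1 : n - 1 ≠ 0 := by linarith
  refine ⟨hn, by positivity, fun t => ?_, fun t => ?_, fun t => ?_, fun t => ?_, fun t => ?_,
    fun t => ?_, fun t => ?_, fun t => ?_, ?_⟩
  · have := hρpos _ (exp_pos t)
    positivity
  · exact div_pos (hmpos _ (exp_pos t)) (exp_pos t)
  · have := hhor _ (exp_pos t)
    rw [← mul_div_assoc, div_lt_one (exp_pos t)]
    linarith
  · have hR := hρpos _ (exp_pos t)
    have h1 : (ρ (exp t) ^ (1 / n)) ^ n = ρ (exp t) := by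
      rw [← rpow_mul hR.le, one_div_mul_cancel hn0, rpow_one]
    have hσ : 0 < K * ρ (exp t) ^ (1 / n) := by positivity
    have h2 : (K * ρ (exp t) ^ (1 / n)) * (K * ρ (exp t) ^ (1 / n)) ^ (n - 1) =
        K ^ n * ρ (exp t) := by
      rw [rpow_sub_one hσ.ne', mul_div_cancel₀ _ hσ.ne', mul_rpow hK.le (by positivity), h1]
    have h3 : exp (2 / (n - 1) * t) ^ (n - 1) = exp t ^ 2 := by
      rw [← exp_mul, ← exp_nat_mul]
      congr 1
      push_cast
      field_simp
    rw [mul_rpow (by positivity) (exp_pos _).le, mul_rpow (by positivity) hσ.le,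
      ← rpow_mul (by positivity), one_div_mul_cancel hn1, rpow_one, h3]
    calc 4 * π * exp t ^ 2 * ρ (exp t)
        = 4 * π / K ^ n * exp t ^ 2 * (K ^ n * ρ (exp t)) := by field_simp
      _ = _ := by
        rw [← h2]
        field_simp
  · have h1 := hDle _ (exp_pos t)
    rw [← mul_div_assoc, le_div_iff₀ (exp_pos t)]
    linarith
  · have hR := hρpos _ (exp_pos t)
    have h1 := ((hρ _ (exp_pos t)).comp t (hasDerivAt_exp t)).rpow_const (p := 1 / n)
      (Or.inl hR.ne')
    refine (h1.const_mul K).congr_deriv ?_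
    simp only [Function.comp_apply]
    rw [rpow_sub_one hR.ne']
    generalize decayRate n _ _ _ = v
    field_simp
  · have h1 := ((hm _ (exp_pos t)).comp t (hasDerivAt_exp t)).div (hasDerivAt_exp t)
      (exp_pos t).ne'
    refine h1.congr_deriv ?_
    simp only [Function.comp_apply]
    field_simp
  · have hR := hρpos _ (exp_pos t)
    have := (hρlt _ (exp_pos t)).le
    gcongr
  · have h1 : Tendsto (fun t => 4 * π / 3 * ρ₀ * exp t ^ 2) atBot (nhds 0) := by
      simpa using (tendsto_exp_atBot.pow 2).const_mul (4 * π / 3 * ρ₀)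
    refine squeeze_zero (fun t => (div_pos (hmpos _ (exp_pos t)) (exp_pos t)).le) (fun t => ?_) h1
    rw [div_le_iff₀ (exp_pos t)]
    linarith [hmle _ (exp_pos t)]

end Polytrope

theorem density_coefficient_eq {K n : ℝ} (hK : 0 < K) (hn : 5 < n) :
    ((2 / (n - 1) * (1 - 2 / (n - 1))) ^ (1 / (n - 1)) /
        ((4 * π / ((n + 1) * K ^ n)) ^ (1 / (n - 1)) * K)) ^ n =
      ((K ^ n / (2 ^ n * π ^ n)) * ((n + 1) ^ n * (n - 3) ^ n / (n - 1) ^ (2 * n))) ^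
        (1 / (n - 1)) := by
  have h1 : 0 < n - 1 := by linarith
  have h2 : 0 < n + 1 := by linarith
  have h3 : 0 < n - 3 := by linarith
  have hb : 2 / (n - 1) * (1 - 2 / (n - 1)) = 2 * (n - 3) / (n - 1) ^ 2 := by
    field_simp
    ring
  have hK1 : K = (K ^ (n - 1)) ^ (1 / (n - 1)) := by
    rw [← rpow_mul hK.le, mul_one_div_cancel h1.ne', rpow_one]
  have hbase : 2 * (n - 3) / (n - 1) ^ 2 / (4 * π / ((n + 1) * K ^ n) * K ^ (n - 1)) =
      K / (2 * π) * ((n + 1) * (n - 3) / (n - 1) ^ 2) := by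
    rw [rpow_sub_one hK.ne']
    field_simp
    ring
  have hsq : (n - 1) ^ (2 * n) = ((n - 1) ^ 2) ^ n := by
    rw [rpow_mul h1.le, rpow_two]
  rw [hb]
  nth_rewrite 2 [hK1]
  rw [← mul_rpow (by positivity) (by positivity), ← div_rpow (by positivity) (by positivity), hbase,
    ← rpow_mul (by positivity), mul_comm (1 / (n - 1)) n, rpow_mul (by positivity),
    mul_rpow (by positivity) (by positivity), div_rpow hK.le (by positivity),
    mul_rpow zero_le_two pi_pos.le, div_rpow (by positivity) (by positivity),
    mul_rpow h2.le h3.le, hsq]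

theorem mass_coefficient_eq {K n : ℝ} (hK : 0 < K) (hn : 5 < n) :
    (n + 1) * (2 / (n - 1)) * ((2 / (n - 1) * (1 - 2 / (n - 1))) ^ (1 / (n - 1)) /
        (4 * π / ((n + 1) * K ^ n)) ^ (1 / (n - 1))) =
      ((2 ^ (n - 2) * K ^ n / π) * ((n - 3) * (n + 1) ^ n / (n - 1) ^ (n + 1))) ^
        (1 / (n - 1)) := by
  have h1 : 0 < n - 1 := by linarith
  have h2 : 0 < n + 1 := by linarith
  have h3 : 0 < n - 3 := by linarith
  have hb : 2 / (n - 1) * (1 - 2 / (n - 1)) = 2 * (n - 3) / (n - 1) ^ 2 := by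
    field_simp
    ring
  have hA : (n + 1) * (2 / (n - 1)) =
      (((n + 1) * (2 / (n - 1))) ^ (n - 1)) ^ (1 / (n - 1)) := by
    rw [← rpow_mul (by positivity), mul_one_div_cancel h1.ne', rpow_one]
  rw [hb, hA, ← div_rpow (by positivity) (by positivity),
    ← mul_rpow (by positivity) (by positivity), mul_rpow h2.le (by positivity),
    div_rpow zero_le_two h1.le, rpow_sub_one h2.ne', rpow_sub_one two_ne_zero, rpow_sub_one h1.ne',
    rpow_sub zero_lt_two, rpow_two, rpow_add_one h1.ne']
  congr 1
  field_simp
  ring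

/-- Asymptotics at infinity of regular solutions of the static spherically
symmetric Einstein–Euler system with power-law polytropic equation of state
p = Kρ^{(n+1)/n}, n > 5, and central density ρ₀ > 0:
m(r) = ((2^{n−2}K^n/π)(n−3)(n+1)^n/(n−1)^{n+1})^{1/(n−1)} r^{(n−3)/(n−1)} + o(r^{(n−3)/(n−1)})
and ρ(r) = ((K^n/(2^nπ^n))(n+1)^n(n−3)^n/(n−1)^{2n})^{1/(n−1)} r^{−2n/(n−1)} + o(r^{−2n/(n−1)}). -/
theorem asymptotics_polytropic_eos (K n ρ₀ : ℝ)
    (hK : K ∈ Set.Ioc (0:ℝ) 1) (hn : 5 < n) (hρ₀ : 0 < ρ₀)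
    (m ρ : ℝ → ℝ)
    (hm_smooth : ContDiffOn ℝ (⊤ : ℕ∞) m (Set.Ioi 0))
    (hρ_smooth : ContDiffOn ℝ (⊤ : ℕ∞) ρ (Set.Ioi 0))
    (hρpos : ∀ r > (0:ℝ), 0 < ρ r)
    (hhor : ∀ r > (0:ℝ), 0 < r - 2 * m r)
    (hm : ∀ r > (0:ℝ), HasDerivAt m (4 * π * r^2 * ρ r) r)
    (hρ : ∀ r > (0:ℝ), HasDerivAt ρ
      (-(n/(n+1)) * ((1 + K * ρ r ^ ((1:ℝ)/n)) * ρ r ^ ((n-1)/n) / (r - 2 * m r))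
        * (4 * π * r^2 * ρ r ^ ((n+1)/n) + m r / (r * K))) r)
    (hm0 : Filter.Tendsto m (nhdsWithin 0 (Set.Ioi 0)) (nhds 0))
    (hρ0 : Filter.Tendsto ρ (nhdsWithin 0 (Set.Ioi 0)) (nhds ρ₀)) :
    (fun r : ℝ => m r -
        ((2 ^ (n-2) * K ^ n / π) * ((n-3) * (n+1) ^ n / (n-1) ^ (n+1))) ^ ((1:ℝ)/(n-1))
          * r ^ ((n-3)/(n-1)))
      =o[atTop] (fun r : ℝ => r ^ ((n-3)/(n-1))) ∧
    (fun r : ℝ => ρ r -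
        ((K ^ n / (2 ^ n * π ^ n)) * ((n+1) ^ n * (n-3) ^ n / (n-1) ^ (2*n))) ^ ((1:ℝ)/(n-1))
          * r ^ (-(2*n)/(n-1)))
      =o[atTop] (fun r : ℝ => r ^ (-(2*n)/(n-1))) := by
  have hK0 := hK.1
  have hn1 : n - 1 ≠ 0 := by linarith
  have hn0 : n ≠ 0 := by linarith
  have hflow := isPolytropicFlow hK0 hn hρpos hhor hm
    (fun r hr => hasDerivAt_density hK0 (by linarith) hr (hρpos r hr) (hhor r hr) (hρ r hr)) hm0 hρ0
  have hk := hflow.k_pos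
  have hX := hflow.scaled_rpow_and_decayRate_tendsto.1
  rw [← mass_coefficient_eq hK0 hn, ← density_coefficient_eq hK0 hn]
  generalize (4 * π / ((n + 1) * K ^ n)) ^ (1 / (n - 1)) = k at *
  constructor
  · refine isLittleO_sub_rpow_of_tendsto
      ((hflow.μ_div_σ_tendsto.mul (hX.div_const k)).congr fun t => ?_)
    have hσ := rpow_pos_of_pos (hρpos _ (exp_pos t)) (1 / n)
    have h1 : exp (-((n - 3) / (n - 1) * t)) = exp (2 / (n - 1) * t) / exp t := by
      rw [← exp_sub]
      congr 1
      field_simp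
      ring
    rw [h1]
    field_simp
  · refine isLittleO_sub_rpow_of_tendsto
      (((hX.div_const (k * K)).rpow_const (p := n) (Or.inr (by linarith))).congr fun t => ?_)
    have hR := hρpos _ (exp_pos t)
    have h1 : k * (K * ρ (exp t) ^ (1 / n)) * exp (2 / (n - 1) * t) / (k * K) =
        ρ (exp t) ^ (1 / n) * exp (2 / (n - 1) * t) := by
      field_simp
    rw [h1, mul_rpow (by positivity) (exp_pos _).le, ← rpow_mul hR.le, one_div_mul_cancel hn0,
      rpow_one, ← exp_mul]
    congr 2
    ring
end

section
/- Fix K ∈ (0,1] and n > 5, and let C = ((2^{n−2} K^n/π)·(n−3)(n+1)^n/(n−1)^{n+1})^{1/(n−1)} and D = ((K^n/(2^n π^n))·(n+1)^n(n−3)^n/(n−1)^{2n})^{1/(n−1)}. Let m, ρ : (0,∞) → ℝ satisfy ρ(r) > 0, 0 < 2m(r) < r for all r > 0, and the asymptotics m(r) = C r^{(n−3)/(n−1)} + o(r^{(n−3)/(n−1)}) and ρ(r) = D r^{−2n/(n−1)} + o(r^{−2n/(n−1)}) as r → ∞. Define ν'(r) = (K/(r(1 − 2m(r)/r))) · (4π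 r² ρ(r)^{(n+1)/n} + m(r)/(rK)). Then as r → ∞: ν'(r) = O(r^{−(n+1)/(n−1)}) and (1 − 2m(r)/r)^{−1} − 1 = O(r^{−2/(n−1)}). In particular both quantities are o(r^{−1/(2(1+β))}) for any β > (n−5)/4, so the associated static metric is scaled quasi-asymptotically flat with scaling exponent β and 1−α = (1+β)^{−2}. -/
open Real Filter Asymptotics

theorem isBigO_of_isLittleO_sub_const_mul {f g : ℝ → ℝ} {c : ℝ} {l : Filter ℝ}
    (h : (fun r => f r - c * g r) =o[l] g) : f =O[l] g := by
  simpa using h.isBigO.add ((isBigO_refl g l).const_mul_left c)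

theorem isBigO_rpow_rpow_atTop {a b : ℝ} (hab : a ≤ b) :
    (fun r : ℝ => r ^ a) =O[atTop] (fun r : ℝ => r ^ b) := by
  refine IsBigO.of_bound 1 ?_
  filter_upwards [eventually_ge_atTop 1] with r hr
  rw [one_mul, Real.norm_of_nonneg (by positivity), Real.norm_of_nonneg (by positivity)]
  exact Real.rpow_le_rpow_of_exponent_le hr hab

theorem isLittleO_rpow_rpow_atTop {a b : ℝ} (hab : a < b) :
    (fun r : ℝ => r ^ a) =o[atTop] (fun r : ℝ => r ^ b) := by
  rw [isLittleO_iff_tendsto']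
  · refine (tendsto_rpow_neg_atTop (sub_pos.2 hab)).congr' ?_
    filter_upwards [eventually_gt_atTop 0] with r hr
    rw [← Real.rpow_sub hr, neg_sub]
  · filter_upwards [eventually_gt_atTop 0] with r hr h
    exact absurd h (Real.rpow_pos_of_pos hr b).ne'

/-- Given the leading-order asymptotics of m and ρ for the polytropic fluid
with n > 5, the quantity ν'(r) = (K/(r(1 − 2m/r)))(4πr²ρ^{(n+1)/n} + m/(rK)) satisfies
ν'(r) = O(r^{−(n+1)/(n−1)}) and (1 − 2m/r)⁻¹ − 1 = O(r^{−2/(n−1)}) as r → ∞; in particular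
both are o(r^{−1/(2(1+β))}) for any β > (n−5)/4. -/
theorem polytropic_scaled_qaf_decay (K n : ℝ) (hK : K ∈ Set.Ioc (0:ℝ) 1) (hn : 5 < n)
    (m ρ : ℝ → ℝ)
    (hρpos : ∀ r > (0:ℝ), 0 < ρ r)
    (hmpos : ∀ r > (0:ℝ), 0 < 2 * m r)
    (hhor : ∀ r > (0:ℝ), 2 * m r < r)
    (hm_asym : (fun r : ℝ => m r -
        ((2 ^ (n-2) * K ^ n / π) * ((n-3) * (n+1) ^ n / (n-1) ^ (n+1))) ^ ((1:ℝ)/(n-1))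
          * r ^ ((n-3)/(n-1)))
      =o[atTop] (fun r : ℝ => r ^ ((n-3)/(n-1))))
    (hρ_asym : (fun r : ℝ => ρ r -
        ((K ^ n / (2 ^ n * π ^ n)) * ((n+1) ^ n * (n-3) ^ n / (n-1) ^ (2*n))) ^ ((1:ℝ)/(n-1))
          * r ^ (-(2*n)/(n-1)))
      =o[atTop] (fun r : ℝ => r ^ (-(2*n)/(n-1)))) :
    ((fun r : ℝ => (K/(r * (1 - 2 * m r / r)))
        * (4 * π * r^2 * ρ r ^ ((n+1)/n) + m r / (r * K)))
      =O[atTop] (fun r : ℝ => r ^ (-(n+1)/(n-1))) ∧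
     (fun r : ℝ => (1 - 2 * m r / r)⁻¹ - 1)
      =O[atTop] (fun r : ℝ => r ^ (-(2:ℝ)/(n-1)))) ∧
    (∀ β > (n-5)/4,
      (fun r : ℝ => (K/(r * (1 - 2 * m r / r)))
          * (4 * π * r^2 * ρ r ^ ((n+1)/n) + m r / (r * K)))
        =o[atTop] (fun r : ℝ => r ^ (-(1/(2*(1+β))))) ∧
      (fun r : ℝ => (1 - 2 * m r / r)⁻¹ - 1)
        =o[atTop] (fun r : ℝ => r ^ (-(1/(2*(1+β)))))) := by
  have hn1 : 0 < n - 1 := by linarith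
  have hn0 : 0 < n := by linarith
  have hm := isBigO_of_isLittleO_sub_const_mul hm_asym
  have hρ := isBigO_of_isLittleO_sub_const_mul hρ_asym
  have hmr : (fun r : ℝ => m r / r) =O[atTop] (fun r : ℝ => r ^ (-(2:ℝ)/(n-1))) := by
    refine (hm.mul (isBigO_refl (fun r : ℝ => r⁻¹) atTop)).congr' (.of_forall fun r => rfl) ?_
    filter_upwards [eventually_gt_atTop 0] with r hr
    rw [← Real.rpow_neg_one, ← Real.rpow_add hr]
    congr 1
    field_simp
    ring
  have hx : (fun r : ℝ => 2 * m r / r) =O[atTop] (fun r : ℝ => r ^ (-(2:ℝ)/(n-1))) :=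
    (hmr.const_mul_left 2).congr_left fun r => by ring
  have hx0 : Tendsto (fun r : ℝ => 2 * m r / r) atTop (nhds 0) := by
    refine hx.trans_tendsto ?_
    simpa only [neg_div] using tendsto_rpow_neg_atTop (div_pos two_pos hn1)
  have hinv : (fun r : ℝ => (1 - 2 * m r / r)⁻¹) =O[atTop] (fun _ : ℝ => (1:ℝ)) := by
    have h : Tendsto (fun r : ℝ => (1 - 2 * m r / r)⁻¹) atTop (nhds (1 - 0)⁻¹) :=
      (hx0.const_sub 1).inv₀ (by norm_num)
    exact h.isBigO_one ℝ
  have hgrr : (fun r : ℝ => (1 - 2 * m r / r)⁻¹ - 1)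
      =O[atTop] (fun r : ℝ => r ^ (-(2:ℝ)/(n-1))) := by
    refine (hx.mul hinv).congr' ?_ (.of_forall fun r => mul_one _)
    filter_upwards [eventually_gt_atTop 0] with r hr
    have h : 1 - 2 * m r / r ≠ 0 := (sub_pos.2 ((div_lt_one hr).2 (hhor r hr))).ne'
    generalize 2 * m r / r = x at h
    field_simp
    ring
  have hpressure : (fun r : ℝ => r^2 * ρ r ^ ((n+1)/n))
      =O[atTop] (fun r : ℝ => r ^ (-(2:ℝ)/(n-1))) := by
    have hpow := hρ.rpow (r := (n+1)/n) (by positivity)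
      ((eventually_gt_atTop 0).mono fun r hr => (Real.rpow_pos_of_pos hr _).le)
    refine (((isBigO_refl (fun r : ℝ => r^2) atTop).mul hpow).congr' .rfl ?_).trans
      (isBigO_rpow_rpow_atTop (a := -4/(n-1))
        (div_le_div_of_nonneg_right (by norm_num) hn1.le))
    filter_upwards [eventually_gt_atTop 0] with r hr
    rw [← Real.rpow_mul hr.le, ← Real.rpow_natCast, ← Real.rpow_add hr]
    congr 1
    push_cast
    field_simp
    ring
  have hbracket : (fun r : ℝ => 4 * π * r^2 * ρ r ^ ((n+1)/n) + m r / (r * K))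
      =O[atTop] (fun r : ℝ => r ^ (-(2:ℝ)/(n-1))) :=
    ((hpressure.const_mul_left (4 * π)).add (hmr.const_mul_left K⁻¹)).congr_left fun r => by
      rw [div_mul_eq_div_div]
      ring
  have hν : (fun r : ℝ => (K/(r * (1 - 2 * m r / r)))
        * (4 * π * r^2 * ρ r ^ ((n+1)/n) + m r / (r * K)))
      =O[atTop] (fun r : ℝ => r ^ (-(n+1)/(n-1))) := by
    have hpre : (fun r : ℝ => K/(r * (1 - 2 * m r / r))) =O[atTop] (fun r : ℝ => r⁻¹) :=
      ((((isBigO_refl (fun r : ℝ => r⁻¹) atTop).mul hinv).const_mul_left K).congr_left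
        fun r => by rw [div_eq_mul_inv K, mul_inv]).congr_right fun r => mul_one _
    refine (hpre.mul hbracket).congr' .rfl ?_
    filter_upwards [eventually_gt_atTop 0] with r hr
    rw [← Real.rpow_neg_one, ← Real.rpow_add hr]
    congr 1
    field_simp
    ring
  refine ⟨⟨hν, hgrr⟩, fun β hβ => ?_⟩
  have hexp : -(2:ℝ)/(n-1) < -(1/(2*(1+β))) := by
    rw [neg_div, neg_lt_neg_iff, div_lt_div_iff₀ (by linarith) hn1]
    linarith
  have hexp' : -(n+1)/(n-1) ≤ -(2:ℝ)/(n-1) :=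
    div_le_div_of_nonneg_right (by linarith) hn1.le
  exact ⟨hν.trans_isLittleO (isLittleO_rpow_rpow_atTop (hexp'.trans_lt hexp)),
    hgrr.trans_isLittleO (isLittleO_rpow_rpow_atTop hexp)⟩
end
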